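/- arXiv:0706.3028 — 3 statements merged into one kernel-verified Lean document; each statement's English description precedes it below -/
import Mathlib

section
/- Let R be a complete regular local ring of prime characteristic p > 0 and let g ∈ R. Then every F-jumping coefficient of the principal ideal (g) is a rational number, and the set of F-jumping coefficients of (g) is a discrete subset of ℝ, i.e. it has no accumulation points in ℝ. -/
/-- The `q`-th bracket power of an ideal: the ideal generated by the `q`-th powers
of the elements of `J`. -/
def bracketPow {R : Type*} [CommRing R] (J : Ideal R) (q : ℕ) : Ideal R :=
  Ideal.span ((fun x => x ^ q) '' (J : Set R))

/-- `Ie p a e` is the intersection of all ideals `I` with `a ⊆ I^{[p^e]}`. -/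
def Ie {R : Type*} [CommRing R] (p : ℕ) (a : Ideal R) (e : ℕ) : Ideal R :=
  sInf {I : Ideal R | a ≤ bracketPow I (p ^ e)}

/-- Condition (*): `a ⊆ I_e(a)^{[p^e]}` for every ideal `a` and every `e ≥ 1`. -/
def CondStar (R : Type*) [CommRing R] (p : ℕ) : Prop :=
  ∀ (a : Ideal R) (e : ℕ), 1 ≤ e → a ≤ bracketPow (Ie p a e) (p ^ e)

/-- The generalized test ideal `τ(a^c)`: the supremum, in the lattice of ideals of `R`,
of the ideals `I_e(a^{⌈c p^e⌉})` for `e ≥ 1`. -/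
noncomputable def tau {R : Type*} [CommRing R] (p : ℕ) (a : Ideal R) (c : ℝ) : Ideal R :=
  ⨆ e : {e : ℕ // 1 ≤ e}, Ie p (a ^ ⌈c * (p : ℝ) ^ (e : ℕ)⌉₊) (e : ℕ)

/-- `c > 0` is an F-jumping coefficient of `a` if `τ(a^c) ≠ τ(a^{c-ε})` for all
`0 < ε < c`. -/
def IsFJumpingCoeff {R : Type*} [CommRing R] (p : ℕ) (a : Ideal R) (c : ℝ) : Prop :=
  0 < c ∧ ∀ ε : ℝ, 0 < ε → ε < c → tau p a c ≠ tau p a (c - ε)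

/-- `x` is an accumulation point of `S ⊆ ℝ`. -/
def IsAccumulationPt (S : Set ℝ) (x : ℝ) : Prop :=
  ∀ ε : ℝ, 0 < ε → ∃ y ∈ S, y ≠ x ∧ |y - x| < ε

/-- `R` is a regular local ring: Noetherian, local, and the maximal ideal is generated
by `dim R` elements. -/
def IsRegularStmt (R : Type*) [CommRing R] [IsLocalRing R] : Prop :=
  ∃ s : Finset R, IsLocalRing.maximalIdeal R = Ideal.span (s : Set R) ∧
    (s.card : WithBot (WithTop ℕ)) = ringKrullDim R

/-! ### Part 1: the combinatorial part -/

def leftAcc (S : Set ℝ) : Set ℝ := {x | 0 < x ∧ ∀ δ > 0, ∃ y ∈ S, x - δ < y ∧ y < x}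

noncomputable def TT (p : ℕ) (j : ℕ) (x : ℝ) : ℝ := (p:ℝ)^j * x - (⌈(p:ℝ)^j * x⌉ - 1)

lemma TT_pos (p j : ℕ) (x : ℝ) : 0 < TT p j x := by
  unfold TT
  have := Int.ceil_lt_add_one ((p:ℝ)^j * x)
  linarith

lemma TT_le (p j : ℕ) (x : ℝ) : TT p j x ≤ 1 := by
  unfold TT
  have := Int.le_ceil ((p:ℝ)^j * x)
  linarith

lemma TT_TT (p i j : ℕ) (x : ℝ) : TT p i (TT p j x) = TT p (i + j) x := by
  unfold TT
  have h : (p:ℝ)^i * ((p:ℝ)^j * x - (⌈(p:ℝ)^j * x⌉ - 1))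
      = (p:ℝ)^(i+j) * x - (((p:ℤ)^i * (⌈(p:ℝ)^j * x⌉ - 1) : ℤ) : ℝ) := by
    push_cast; ring
  rw [h, Int.ceil_sub_intCast]
  push_cast; ring

lemma TT_left (p : ℕ) (hp : 2 ≤ p) (j : ℕ) (x : ℝ) :
    ∃ δ > 0, ∀ y, x - δ < y → y ≤ x → TT p j y ≤ TT p j x := by
  have hp0 : (0:ℝ) < (p:ℝ)^j := by positivity
  refine ⟨TT p j x / (p:ℝ)^j, div_pos (TT_pos _ _ _) hp0, fun y h1 h2 => ?_⟩
  have h3 : (p:ℝ)^j * y ≤ (p:ℝ)^j * x := by gcongr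
  have h4 : (p:ℝ)^j * x - TT p j x < (p:ℝ)^j * y := by
    have : (p:ℝ)^j * (x - TT p j x / (p:ℝ)^j) < (p:ℝ)^j * y := by gcongr
    rwa [mul_sub, mul_div_cancel₀ _ hp0.ne'] at this
  have h5 : ⌈(p:ℝ)^j * y⌉ = ⌈(p:ℝ)^j * x⌉ := by
    rw [Int.ceil_eq_iff]
    constructor
    · unfold TT at h4; linarith
    · exact h3.trans (Int.le_ceil _)
  unfold TT
  rw [h5]; linarith

lemma sub_nat_mem {S : Set ℝ} (hsub : ∀ c ∈ S, 1 < c → c - 1 ∈ S) (n : ℕ) :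
    ∀ x ∈ S, (n:ℝ) < x → x - n ∈ S := by
  induction n with
  | zero => intro x hx _; simpa using hx
  | succ n ih =>
    intro x hx h
    push_cast at h ⊢
    have h1 := ih x hx (by linarith)
    have := hsub _ h1 (by linarith)
    convert this using 1; ring

lemma mul_pow_mem {S : Set ℝ} {p : ℕ} (hmul : ∀ c ∈ S, (p:ℝ) * c ∈ S) (n : ℕ) :
    ∀ x ∈ S, (p:ℝ)^n * x ∈ S := by
  induction n with
  | zero => intro x hx; simpa using hx
  | succ n ih =>
    intro x hx
    have := hmul _ (ih x hx)
    convert this using 1; ring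

lemma TT_mem {S : Set ℝ} {p : ℕ} (hp : 2 ≤ p) (hpos : ∀ c ∈ S, 0 < c)
    (hmul : ∀ c ∈ S, (p:ℝ) * c ∈ S)
    (hsub : ∀ c ∈ S, 1 < c → c - 1 ∈ S) (j : ℕ) (x : ℝ) (hx : x ∈ S) : TT p j x ∈ S := by
  have h1 := mul_pow_mem hmul j x hx
  have h0 := hpos _ h1
  have h2 : 0 < ⌈(p:ℝ)^j * x⌉ := Int.ceil_pos.mpr h0
  obtain ⟨n, hn⟩ := Int.eq_ofNat_of_zero_le (show 0 ≤ ⌈(p:ℝ)^j * x⌉ - 1 by omega)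
  have hn' : ((⌈(p:ℝ)^j * x⌉ : ℝ) - 1) = n := by exact_mod_cast hn
  have := sub_nat_mem hsub n _ h1 (by have := TT_pos p j x; unfold TT at this; linarith)
  unfold TT
  rwa [hn']

lemma TT_eq_imp {p : ℕ} (hp : 2 ≤ p) {j : ℕ} (hj : 1 ≤ j) {x : ℝ} (hx : 0 < x)
    (h : TT p j x = x) : ∃ m : ℕ, 1 ≤ m ∧ x = m / ((p:ℝ)^j - 1) := by
  have h1 : (1:ℝ) < (p:ℝ)^j := one_lt_pow₀ (by exact_mod_cast hp) (by omega)
  have h2 : x * ((p:ℝ)^j - 1) = ((⌈(p:ℝ)^j * x⌉ - 1 : ℤ) : ℝ) := by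
    unfold TT at h; push_cast; linarith
  have h3 : 0 < x * ((p:ℝ)^j - 1) := mul_pos hx (by linarith)
  rw [h2] at h3
  have h4 : 0 < ⌈(p:ℝ)^j * x⌉ - 1 := by exact_mod_cast h3
  obtain ⟨n, hn⟩ := Int.eq_ofNat_of_zero_le h4.le
  refine ⟨n, by omega, ?_⟩
  rw [eq_div_iff (by linarith), h2, hn]; simp

lemma TT_rat {p : ℕ} (hp : 2 ≤ p) {i j : ℕ} (hij : i < j) {x : ℝ}
    (h : TT p i x = TT p j x) : ∃ q : ℚ, x = q := by
  have h1 : (p:ℝ)^i < (p:ℝ)^j := pow_lt_pow_right₀ (by exact_mod_cast hp) hij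
  refine ⟨((⌈(p:ℝ)^j * x⌉ - ⌈(p:ℝ)^i * x⌉ : ℤ) : ℚ) / ((p:ℚ)^j - (p:ℚ)^i), ?_⟩
  push_cast
  rw [eq_div_iff (by linarith)]
  unfold TT at h
  linarith

lemma leftAcc_sSup {S : Set ℝ} (B : Set ℝ) (hB : B ⊆ leftAcc S) (hne : B.Nonempty)
    (hb : BddAbove B) : sSup B ∈ leftAcc S := by
  by_cases hz : sSup B ∈ B
  · exact hB hz
  obtain ⟨b, hbB⟩ := hne
  refine ⟨(hB hbB).1.trans_le (le_csSup hb hbB), fun δ hδ => ?_⟩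
  obtain ⟨b', hb', h1⟩ := exists_lt_of_lt_csSup ⟨b, hbB⟩ (show sSup B - δ < sSup B by linarith)
  obtain ⟨y, hy, h2, h3⟩ := (hB hb').2 (b' - (sSup B - δ)) (by linarith)
  exact ⟨y, hy, by linarith, h3.trans_le (le_csSup hb hb')⟩

lemma leftAcc_min {S : Set ℝ}
    (hright : ∀ x : ℝ, 0 ≤ x → ∃ δ > 0, ∀ y ∈ S, ¬ (x < y ∧ y < x + δ))
    (U : Set ℝ) (hU : U ⊆ leftAcc S) (hne : U.Nonempty) : sInf U ∈ U := by
  have hbb : BddBelow U := ⟨0, fun u hu => (hU hu).1.le⟩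
  have h0 : 0 ≤ sInf U := le_csInf hne (fun u hu => (hU hu).1.le)
  obtain ⟨δ, hδ, h⟩ := hright _ h0
  obtain ⟨u, hu, h1⟩ := exists_lt_of_csInf_lt hne (show sInf U < sInf U + δ by linarith)
  have h2 := csInf_le hbb hu
  rcases h2.eq_or_lt with h3 | h3
  · rwa [h3]
  · obtain ⟨y, hy, h4, h5⟩ := (hU hu).2 (u - sInf U) (by linarith)
    exact absurd ⟨by linarith, by linarith⟩ (h y hy)

lemma leftAcc_empty {p : ℕ} (hp : 2 ≤ p) {S : Set ℝ}
    (hmul : ∀ c ∈ S, (p:ℝ) * c ∈ S)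
    (hsub : ∀ c ∈ S, 1 < c → c - 1 ∈ S)
    (hright : ∀ x : ℝ, 0 ≤ x → ∃ δ > 0, ∀ y ∈ S, ¬ (x < y ∧ y < x + δ))
    (hrat : ∀ k m : ℕ, 1 ≤ k → 1 ≤ m → ∃ δ > 0, ∀ y ∈ S,
      ¬ ((m:ℝ) / ((p:ℝ)^k - 1) - δ < y ∧ y < (m:ℝ) / ((p:ℝ)^k - 1)))
    (x : ℝ) : x ∉ leftAcc S := by
  intro hx
  set A := leftAcc S with hA
  have hp0 : (0:ℝ) < p := by positivity
  have Apos : ∀ c ∈ A, 0 < c := fun c hc => hc.1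
  have Amul : ∀ c ∈ A, (p:ℝ) * c ∈ A := by
    intro c hc
    refine ⟨by have := hc.1; positivity, fun δ hδ => ?_⟩
    obtain ⟨y, hy, h1, h2⟩ := hc.2 (δ / p) (by positivity)
    refine ⟨p * y, hmul y hy, ?_, by gcongr⟩
    have : (p:ℝ) * (c - δ / p) < p * y := by gcongr
    rwa [mul_sub, mul_div_cancel₀ _ hp0.ne'] at this
  have Asub : ∀ c ∈ A, 1 < c → c - 1 ∈ A := by
    intro c hc h1
    refine ⟨by linarith, fun δ hδ => ?_⟩
    obtain ⟨y, hy, h2, h3⟩ := hc.2 (min δ (c - 1)) (lt_min hδ (by linarith))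
    have := min_le_left δ (c-1)
    have := min_le_right δ (c-1)
    exact ⟨y - 1, hsub y hy (by linarith), by linarith, by linarith⟩
  have ATT : ∀ j, ∀ y ∈ A, TT p j y ∈ A := fun j y hy => TT_mem hp Apos Amul Asub j y hy
  have nper : ∀ j, 1 ≤ j → ∀ y ∈ A, TT p j y ≠ y := by
    intro j hj y hy h
    obtain ⟨m, hm, hym⟩ := TT_eq_imp hp hj (Apos y hy) h
    obtain ⟨δ, hδ, h⟩ := hrat j m hj hm
    obtain ⟨z, hz, h1, h2⟩ := hy.2 δ hδ
    rw [hym] at h1 h2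
    exact h z hz ⟨h1, h2⟩
  -- records from below
  let V : ℝ → Set ℝ := fun x => {v | ∃ n, v = TT p n x ∧ ∀ k, n ≤ k → TT p n x ≤ TT p k x}
  have VA : ∀ x ∈ A, V x ⊆ A := by
    rintro x hx _ ⟨n, rfl, -⟩; exact ATT n x hx
  have V1 : ∀ x, BddAbove (V x) := by
    rintro x; refine ⟨1, ?_⟩; rintro _ ⟨n, rfl, -⟩; exact TT_le _ _ _
  have Vex : ∀ x ∈ A, ∀ N, ∃ n, N ≤ n ∧ ∀ k, n ≤ k → TT p n x ≤ TT p k x := by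
    intro x hx N
    have := leftAcc_min hright {v | ∃ n, N ≤ n ∧ v = TT p n x}
      (by rintro _ ⟨n, -, rfl⟩; exact ATT n x hx) ⟨_, N, le_rfl, rfl⟩
    obtain ⟨n, hn, h⟩ := this
    refine ⟨n, hn, fun k hk => ?_⟩
    rw [← h]
    exact csInf_le ⟨0, by rintro _ ⟨n, -, rfl⟩; exact (TT_pos _ _ _).le⟩ ⟨k, hn.trans hk, rfl⟩
  let B : Set ℝ := {y | y ∈ A ∧ y ≤ 1 ∧ ∀ j, y ≤ TT p j y}
  have VB : ∀ x ∈ A, sSup (V x) ∈ B := by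
    intro x hx
    obtain ⟨n0, -, hn0⟩ := Vex x hx 0
    have hne : (V x).Nonempty := ⟨_, n0, rfl, hn0⟩
    refine ⟨leftAcc_sSup _ (VA x hx) hne (V1 x), csSup_le hne ?_, fun j => csSup_le hne ?_⟩
    · rintro _ ⟨n, rfl, -⟩; exact TT_le _ _ _
    · rintro _ ⟨n, rfl, hn⟩
      obtain ⟨δ, hδ, h⟩ := TT_left p hp j (sSup (V x))
      obtain ⟨_, ⟨n', rfl, hn'⟩, h1⟩ := exists_lt_of_lt_csSup hne
        (show sSup (V x) - δ < sSup (V x) by linarith)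
      obtain ⟨k, hk, hk'⟩ := Vex x hx (max n n')
      have h2 := h (TT p k x) (h1.trans_le (hn' k ((le_max_right _ _).trans hk)))
        (le_csSup (V1 x) ⟨k, rfl, hk'⟩)
      rw [TT_TT] at h2
      exact (hn (j + k) (by have := (le_max_left n n').trans hk; omega)).trans h2
  have hBne : B.Nonempty := ⟨_, VB x hx⟩
  have hBb : BddAbove B := ⟨1, fun y hy => hy.2.1⟩
  have hy : sSup B ∈ B := by
    refine ⟨leftAcc_sSup _ (fun y hy => hy.1) hBne hBb, csSup_le hBne fun y hy => hy.2.1,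
      fun j => ?_⟩
    obtain ⟨δ, hδ, h⟩ := TT_left p hp j (sSup B)
    refine csSup_le hBne fun b hb => ?_
    obtain ⟨b', hb', h1⟩ := exists_lt_of_lt_csSup hBne (show sSup B - δ < sSup B by linarith)
    rcases le_total b b' with hbb | hbb
    · exact hbb.trans ((hb'.2.2 j).trans (h b' h1 (le_csSup hBb hb')))
    · exact (hb.2.2 j).trans (h b (h1.trans_le hbb) (le_csSup hBb hb))
  obtain ⟨k, hk, hk'⟩ := Vex _ hy.1 1
  have h1 : TT p k (sSup B) ≤ sSup (V (sSup B)) := le_csSup (V1 _) ⟨k, rfl, hk'⟩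
  have h2 : sSup B < TT p k (sSup B) := lt_of_le_of_ne (hy.2.2 k) (nper k hk _ hy.1).symm
  have h3 := le_csSup hBb (VB _ hy.1)
  linarith

theorem real_part {p : ℕ} (hp : 2 ≤ p) {S : Set ℝ} (hpos : ∀ c ∈ S, 0 < c)
    (hmul : ∀ c ∈ S, (p:ℝ) * c ∈ S)
    (hsub : ∀ c ∈ S, 1 < c → c - 1 ∈ S)
    (hright : ∀ x : ℝ, 0 ≤ x → ∃ δ > 0, ∀ y ∈ S, ¬ (x < y ∧ y < x + δ))
    (hrat : ∀ k m : ℕ, 1 ≤ k → 1 ≤ m → ∃ δ > 0, ∀ y ∈ S,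
      ¬ ((m:ℝ) / ((p:ℝ)^k - 1) - δ < y ∧ y < (m:ℝ) / ((p:ℝ)^k - 1))) :
    (∀ c ∈ S, ∃ q : ℚ, c = (q : ℝ)) ∧ (∀ x : ℝ, ¬ IsAccumulationPt S x) := by
  have hacc : ∀ x : ℝ, ¬ IsAccumulationPt S x := by
    intro x hx
    have hx0 : 0 ≤ x := by
      by_contra hneg
      push Not at hneg
      obtain ⟨y, hy, -, h⟩ := hx (-x) (by linarith)
      have := hpos y hy
      have := (abs_lt.mp h).2
      linarith
    obtain ⟨δ, hδ, h⟩ := hright x hx0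
    have key : ∀ ε > 0, ∃ y ∈ S, x - ε < y ∧ y < x := by
      intro ε hε
      obtain ⟨y, hy, hne, h1⟩ := hx (min ε δ) (lt_min hε hδ)
      have h2 := abs_lt.mp h1
      have := min_le_left ε δ
      have := min_le_right ε δ
      refine ⟨y, hy, by linarith, ?_⟩
      rcases lt_or_gt_of_ne hne with h3 | h3
      · exact h3
      · exact absurd ⟨h3, by linarith⟩ (h y hy)
    obtain ⟨y, hy, -, h1⟩ := key 1 one_pos
    exact leftAcc_empty hp hmul hsub hright hrat x ⟨(hpos y hy).trans h1, key⟩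
  refine ⟨fun c hc => ?_, hacc⟩
  by_contra hirr
  have hinj : Function.Injective (fun j => TT p j c) := by
    intro i j hij
    rcases lt_trichotomy i j with h | h | h
    · exact absurd (TT_rat hp h hij) hirr
    · exact h
    · exact absurd (TT_rat hp h hij.symm) hirr
  have hinf : (Set.range (fun j => TT p j c)).Infinite := Set.infinite_range_of_injective hinj
  obtain ⟨x, -, hx⟩ := hinf.exists_accPt_of_subset_isCompact (isCompact_Icc (a := (0:ℝ)) (b := 1))
    (by rintro _ ⟨j, rfl⟩; exact ⟨(TT_pos _ _ _).le, TT_le _ _ _⟩)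
  refine hacc x fun ε hε => ?_
  rw [accPt_iff_nhds] at hx
  obtain ⟨y, ⟨hy1, ⟨j, rfl⟩⟩, hne⟩ := hx (Metric.ball x ε) (Metric.ball_mem_nhds x hε)
  exact ⟨_, TT_mem hp hpos hmul hsub j c hc, hne, by simpa [Real.dist_eq] using hy1⟩

/-! ### Part 2: regular local rings are domains; regular sequences -/

lemma wb_cancel {n : ℕ} {d : WithBot ℕ∞} (h : (n : WithBot ℕ∞) + 1 ≤ d + 1) : (n : WithBot ℕ∞) ≤ d := by
  induction d with
  | bot => exact absurd h (by simp)
  | coe d =>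
    induction d with
    | top => exact le_top
    | coe d =>
      norm_cast at h ⊢
      omega

theorem dom_aux.{u} (n : ℕ) : ∀ (R : Type u) [CommRing R] [IsLocalRing R] [IsNoetherianRing R]
    (s : Finset R), IsLocalRing.maximalIdeal R = Ideal.span (s : Set R) → s.card ≤ n →
    (n : WithBot ℕ∞) ≤ ringKrullDim R → IsDomain R := by
  classical
  induction n with
  | zero =>
    intro R _ _ _ s hs hc _
    have : s = ∅ := Finset.card_eq_zero.mp (by omega)
    subst this
    have hf : IsField R := by
      rw [IsLocalRing.isField_iff_maximalIdeal_eq, hs]; simp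
    exact hf.isDomain
  | succ n ih =>
    intro R _ _ _ s hs hc hd
    set m := IsLocalRing.maximalIdeal R with hm
    have hd0 : ¬ (ringKrullDim R ≤ 0) := by
      intro h
      have h1 := hd.trans h
      have : ((n+1 : ℕ) : WithBot ℕ∞) ≤ ((0:ℕ) : WithBot ℕ∞) := by simpa using h1
      have : n + 1 ≤ 0 := by exact_mod_cast this
      omega
    have hht : (m.height : WithBot ℕ∞) = ringKrullDim R :=
      IsLocalRing.maximalIdeal_height_eq_ringKrullDim
    have hmin : m ∉ minimalPrimes R := by
      intro h
      have : m.height = 0 := by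
        rw [Ideal.height_eq_zero_iff]; exact h
      rw [this] at hht
      exact hd0 (by rw [← hht]; simp)
    have hfin := minimalPrimes.finite_of_isNoetherianRing R
    have hx : ∃ x ∈ m, x ∉ m ^ 2 ∧ ∀ P ∈ minimalPrimes R, x ∉ P := by
      by_contra hcon
      push Not at hcon
      have h1 : (m : Set R) ⊆ ⋃ i ∈ (↑(insert (m^2) hfin.toFinset) : Set (Ideal R)), (id i : Ideal R) := by
        intro x hx
        by_cases h2 : x ∈ m ^ 2
        · simp only [Set.mem_iUnion]
          exact ⟨m^2, by simp, h2⟩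
        · obtain ⟨P, hP, hxP⟩ := hcon x hx h2
          simp only [Set.mem_iUnion]
          exact ⟨P, by simp [hP], hxP⟩
      rw [Ideal.subset_union_prime (m^2) (m^2) (by
        intro i hi h _
        have : i ∈ minimalPrimes R := by
          rcases Finset.mem_insert.mp hi with h' | h'
          · exact absurd h' h
          · simpa using h'
        exact Ideal.IsMinimalPrime.isPrime this)] at h1
      obtain ⟨i, hi, hle⟩ := h1
      rcases Finset.mem_insert.mp hi with rfl | h'
      · have hb : m = ⊥ := by
          apply Submodule.eq_bot_of_le_smul_of_le_jacobson_bot m m (IsNoetherian.noetherian m)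
          · have : m ≤ m^2 := hle
            rwa [pow_two] at this
          · exact IsLocalRing.maximalIdeal_le_jacobson _
        have := IsLocalRing.isField_iff_maximalIdeal_eq.mpr hb
        exact hd0 (le_of_eq (ringKrullDim_eq_zero_of_isField this))
      · have hP : i ∈ minimalPrimes R := by simpa using h'
        have hPp := Ideal.IsMinimalPrime.isPrime hP
        have : i = m := le_antisymm (IsLocalRing.le_maximalIdeal hPp.ne_top) hle
        exact hmin (this ▸ hP)
    obtain ⟨x, hxm, hx2, hxP⟩ := hx
    -- quotient
    have hxs : x ∈ Ideal.span (s : Set R) := hs ▸ hxm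
    obtain ⟨a, ha⟩ := Submodule.mem_span_finset.mp hxs
    have hunit : ∃ i ∈ s, IsUnit (a i) := by
      by_contra hcon
      push Not at hcon
      apply hx2
      rw [← ha.2, pow_two]
      refine Ideal.sum_mem _ fun i hi => ?_
      rw [smul_eq_mul]
      refine Ideal.mul_mem_mul ((IsLocalRing.mem_maximalIdeal _).mpr (hcon i hi)) ?_
      rw [hs]; exact Ideal.subset_span hi
    obtain ⟨i, his, hiu⟩ := hunit
    have hxtop : Ideal.span {x} ≠ ⊤ := by
      intro h
      have : Ideal.span {x} ≤ m := by
        rw [Ideal.span_singleton_le_iff_mem]; exact hxm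
      rw [h] at this
      exact (IsLocalRing.maximalIdeal.isMaximal R).ne_top (top_le_iff.mp this)
    have : Nontrivial (R ⧸ Ideal.span {x}) := Ideal.Quotient.nontrivial_iff.mpr hxtop
    have : IsLocalRing (R ⧸ Ideal.span {x}) :=
      IsLocalRing.of_surjective' (Ideal.Quotient.mk _) Ideal.Quotient.mk_surjective
    let φ := Ideal.Quotient.mk (Ideal.span {x})
    have hmx : IsLocalRing.maximalIdeal (R ⧸ Ideal.span {x}) = m.map φ := by
      refine (IsLocalRing.eq_maximalIdeal ?_).symm
      refine (Ideal.map_eq_top_or_isMaximal_of_surjective φ Ideal.Quotient.mk_surjective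
        (IsLocalRing.maximalIdeal.isMaximal R)).resolve_left ?_
      intro h
      have h1 := Ideal.comap_map_of_surjective φ Ideal.Quotient.mk_surjective m
      rw [h, Ideal.comap_top, ← RingHom.ker_eq_comap_bot, Ideal.mk_ker] at h1
      have : m ⊔ Ideal.span {x} = m := by
        rw [sup_eq_left, Ideal.span_singleton_le_iff_mem]; exact hxm
      rw [this] at h1
      exact (IsLocalRing.maximalIdeal.isMaximal R).ne_top h1.symm
    have hdom : IsDomain (R ⧸ Ideal.span {x}) := by
      refine ih _ ((s.erase i).image φ) ?_ ?_ ?_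
      · rw [hmx, hs, Ideal.map_span]
        apply le_antisymm
        · rw [Ideal.span_le]
          rintro _ ⟨y, hy, rfl⟩
          by_cases hyi : y = i
          · subst hyi
            have h0 : φ x = 0 := Ideal.Quotient.eq_zero_iff_mem.mpr (Ideal.mem_span_singleton_self x)
            have h0' : φ (∑ z ∈ s, a z • z) = 0 := by rw [ha.2]; exact h0
            rw [← Finset.add_sum_erase _ _ his, map_add] at h0'
            replace h0 := h0'
            simp only [smul_eq_mul, map_mul, map_sum] at h0
            have h1 : φ (a y) * φ y ∈ Ideal.span (((s.erase y).image φ : Finset _) : Set (R ⧸ Ideal.span {x})) := by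
              rw [eq_neg_of_add_eq_zero_left h0]
              refine neg_mem (Ideal.sum_mem _ fun z hz => Ideal.mul_mem_left _ _ ?_)
              exact Ideal.subset_span (by simp only [Finset.coe_image]; exact ⟨z, hz, rfl⟩)
            exact (Ideal.unit_mul_mem_iff_mem _ (hiu.map φ)).mp h1
          · exact Ideal.subset_span (by
              simp only [Finset.coe_image]; exact ⟨y, by simpa [hyi] using hy, rfl⟩)
        · apply Ideal.span_mono
          simp only [Finset.coe_image]
          exact Set.image_mono (by simp)
      · refine Finset.card_image_le.trans ?_
        rw [Finset.card_erase_of_mem his]; omega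
      · have h1 := Ideal.height_le_ringKrullDim_quotient_add_one hxm
        rw [hht] at h1
        have h2 := hd.trans h1
        push_cast at h2
        exact wb_cancel h2
    have hxp : (Ideal.span {x}).IsPrime := (Ideal.Quotient.isDomain_iff_prime _).mp hdom
    obtain ⟨P, hP, hPx⟩ := Ideal.exists_minimalPrimes_le (I := (⊥ : Ideal R)) (J := Ideal.span {x}) bot_le
    have hPp := Ideal.IsMinimalPrime.isPrime hP
    have hxnP := hxP P hP
    have hPbot : P = ⊥ := by
      apply Submodule.eq_bot_of_le_smul_of_le_jacobson_bot m P (IsNoetherian.noetherian P)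
      · intro y hy
        obtain ⟨z, rfl⟩ := Ideal.mem_span_singleton'.mp (hPx hy)
        have hz : z ∈ P := (hPp.mem_or_mem hy).resolve_right hxnP
        rw [mul_comm]
        exact Ideal.mul_mem_mul hxm hz
      · exact IsLocalRing.maximalIdeal_le_jacobson _
    rw [hPbot] at hPp
    exact IsDomain.of_bot_isPrime R


theorem quot_dom {R : Type*} [CommRing R] [IsLocalRing R] [IsNoetherianRing R]
    (L₁ L₂ : List R) (hm : Ideal.ofList (L₁ ++ L₂) = IsLocalRing.maximalIdeal R)
    (hd : ((L₁.length + L₂.length : ℕ) : WithBot ℕ∞) ≤ ringKrullDim R) :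
    (Ideal.ofList L₁).IsPrime := by
  classical
  set I := Ideal.ofList L₁ with hI
  set m := IsLocalRing.maximalIdeal R with hmm
  have hIm : I ≤ m := by rw [← hm, Ideal.ofList_append]; exact le_sup_left
  have hmmax := IsLocalRing.maximalIdeal.isMaximal R
  have hItop : I ≠ ⊤ := fun h => hmmax.ne_top (top_le_iff.mp (h ▸ hIm))
  have : Nontrivial (R ⧸ I) := Ideal.Quotient.nontrivial_iff.mpr hItop
  have : IsLocalRing (R ⧸ I) :=
    IsLocalRing.of_surjective' (Ideal.Quotient.mk _) Ideal.Quotient.mk_surjective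
  let φ := Ideal.Quotient.mk I
  have hmx : IsLocalRing.maximalIdeal (R ⧸ I) = m.map φ := by
    refine (IsLocalRing.eq_maximalIdeal ?_).symm
    refine (Ideal.map_eq_top_or_isMaximal_of_surjective φ Ideal.Quotient.mk_surjective
      hmmax).resolve_left ?_
    intro h
    have h1 := Ideal.comap_map_of_surjective φ Ideal.Quotient.mk_surjective m
    rw [h, Ideal.comap_top, ← RingHom.ker_eq_comap_bot, Ideal.mk_ker, sup_eq_left.mpr hIm] at h1
    exact hmmax.ne_top h1.symm
  have hdom : IsDomain (R ⧸ I) := by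
    refine dom_aux L₂.length _ ((L₂.map φ).toFinset) ?_ ?_ ?_
    · rw [hmx, ← hm, Ideal.ofList_append, Ideal.map_sup]
      have : (Ideal.ofList L₁).map φ = ⊥ := by
        rw [Ideal.map_eq_bot_iff_le_ker, Ideal.mk_ker]
      rw [this, bot_sup_eq, Ideal.map_ofList]
      simp [Ideal.ofList]
    · exact (List.toFinset_card_le _).trans (by simp)
    · have h1 := ringKrullDim_le_ringKrullDim_quotient_add_card L₁.toFinset (by
        rw [IsLocalRing.ringJacobson_eq_maximalIdeal]
        refine Set.Subset.trans ?_ hIm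
        intro x hx
        exact Ideal.subset_span (by simpa using hx))
      have h2 : Ideal.span (L₁.toFinset : Set R) = I := by simp [hI, Ideal.ofList]
      rw [h2] at h1
      have h3 : ((L₁.length + L₂.length : ℕ) : WithBot ℕ∞) ≤ ringKrullDim (R ⧸ I) + (L₁.length : WithBot ℕ∞) :=
        (hd.trans h1).trans (by
          gcongr
          exact_mod_cast List.toFinset_card_le L₁)
      clear h1
      generalize ringKrullDim (R ⧸ I) = d at h3
      induction d with
      | bot => exact absurd h3 (by simp)
      | coe d =>
        induction d with
        | top => exact le_top
        | coe d =>
          norm_cast at h3 ⊢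
          omega
  exact (Ideal.Quotient.isDomain_iff_prime _).mp hdom

theorem reg_seq {R : Type*} [CommRing R] [IsLocalRing R] [IsNoetherianRing R]
    (L : List R) (hm : Ideal.ofList L = IsLocalRing.maximalIdeal R)
    (hd : (L.length : WithBot ℕ∞) ≤ ringKrullDim R) :
    RingTheory.Sequence.IsWeaklyRegular R L := by
  classical
  refine ⟨fun i hi => ?_⟩
  have hpr : (Ideal.ofList (L.take i)).IsPrime := by
    apply quot_dom (L.take i) (L.drop i)
    · rw [List.take_append_drop]; exact hm
    · rw [← List.length_append, List.take_append_drop]; exact hd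
  have hnot : L[i] ∉ Ideal.ofList (L.take i) := by
    intro h
    have hL : L = L.take i ++ L[i] :: L.drop (i+1) := by simp
    have h1 : Ideal.span (((L.take i ++ L.drop (i+1)).toFinset : Finset R) : Set R)
        = IsLocalRing.maximalIdeal R := by
      have e1 : Ideal.span (((L.take i ++ L.drop (i+1)).toFinset : Finset R) : Set R)
        = Ideal.ofList (L.take i ++ L.drop (i+1)) := by
          unfold Ideal.ofList; congr 1; ext; simp
      rw [e1]
      conv_rhs => rw [← hm, hL]
      rw [Ideal.ofList_append, Ideal.ofList_append, Ideal.ofList_cons, ← sup_assoc]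
      congr 1
      rw [eq_comm, sup_eq_left, Ideal.span_singleton_le_iff_mem]
      exact h
    have h2 : (IsLocalRing.maximalIdeal R).height ≤ ((L.take i ++ L.drop (i+1)).toFinset).card := by
      apply Ideal.height_le_card_of_mem_minimalPrimes_span_finset
      rw [h1]
      rw [Ideal.minimalPrimes_eq_subsingleton_self]; simp
    have h3 : ((L.take i ++ L.drop (i+1)).toFinset).card < L.length := by
      refine lt_of_le_of_lt (List.toFinset_card_le _) ?_
      simp; omega
    rw [← IsLocalRing.maximalIdeal_height_eq_ringKrullDim] at hd
    have h4 : ((L.length : ℕ) : ℕ∞) ≤ (IsLocalRing.maximalIdeal R).height := by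
      exact_mod_cast hd
    have h5 := h4.trans h2
    have : L.length ≤ ((L.take i ++ L.drop (i+1)).toFinset).card := by exact_mod_cast h5
    omega
  rw [isSMulRegular_quotient_iff_mem_of_smul_mem]
  intro x hx
  simp only [smul_eq_mul, Ideal.mul_top] at hx ⊢
  exact (hpr.mem_or_mem hx).resolve_left hnot

/-! ### lengths -/

/-- colon ideal `A : b` -/
def cl {R : Type*} [CommRing R] (A : Ideal R) (b : R) : Ideal R :=
  Submodule.comap (LinearMap.mulLeft R b) A

lemma mem_cl {R : Type*} [CommRing R] {A : Ideal R} {b x : R} : x ∈ cl A b ↔ b * x ∈ A := Iff.rfl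

/-- colength -/
noncomputable def len {R : Type*} [CommRing R] (A : Ideal R) : ℕ∞ := Module.length R (R ⧸ A)

section
variable {R : Type*} [CommRing R]

lemma len_top : len (⊤ : Ideal R) = 0 := by
  unfold len
  rw [Module.length_eq_zero_iff]
  exact Ideal.Quotient.subsingleton_iff.mpr rfl

lemma len_mono {A B : Ideal R} (h : A ≤ B) : len B ≤ len A := by
  unfold len
  rw [Module.length_quotient, Module.length_quotient]
  exact Order.coheight_anti h

lemma len_eq {A B : Ideal R} (h : A ≤ B) (hl : len A ≤ len B) (hfin : len A ≠ ⊤) : A = B := by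
  by_contra hne
  have hlt : A < B := lt_of_le_of_ne h hne
  have hB : len B < ⊤ := lt_of_le_of_lt (len_mono h) (lt_top_iff_ne_top.mpr hfin)
  unfold len at *
  rw [Module.length_quotient, Module.length_quotient] at *
  exact absurd (Order.coheight_strictAnti hlt hB) (not_lt.mpr hl)

lemma len_cl (A : Ideal R) (b : R) : len A = len (cl A b) + len (A ⊔ Ideal.span {b}) := by
  unfold len cl
  refine Module.length_eq_add_of_exact
    (Submodule.mapQ (Submodule.comap (LinearMap.mulLeft R b) A) A (LinearMap.mulLeft R b) le_rfl)
    (Submodule.mapQ A (A ⊔ Ideal.span {b}) LinearMap.id le_sup_left) ?_ ?_ ?_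
  · rw [← LinearMap.ker_eq_bot, Submodule.ker_mapQ]
    exact (Submodule.eq_bot_iff _).mpr (by
      rintro _ ⟨x, hx, rfl⟩
      exact (Submodule.Quotient.mk_eq_zero _).mpr hx)
  · intro y
    obtain ⟨x, rfl⟩ := Submodule.Quotient.mk_surjective _ y
    exact ⟨Submodule.Quotient.mk x, by simp⟩
  · intro y
    obtain ⟨x, rfl⟩ := Submodule.Quotient.mk_surjective _ y
    rw [Submodule.mapQ_apply, LinearMap.id_apply, Submodule.Quotient.mk_eq_zero]
    constructor
    · intro hx
      obtain ⟨a, ha, c, hc, rfl⟩ := Submodule.mem_sup.mp hx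
      obtain ⟨d, rfl⟩ := Ideal.mem_span_singleton'.mp hc
      refine ⟨Submodule.Quotient.mk d, ?_⟩
      rw [Submodule.mapQ_apply, eq_comm, Submodule.Quotient.eq]
      simp only [LinearMap.mulLeft_apply]
      convert ha using 1; ring
    · rintro ⟨z, hz⟩
      obtain ⟨z, rfl⟩ := Submodule.Quotient.mk_surjective _ z
      rw [Submodule.mapQ_apply, eq_comm, Submodule.Quotient.eq] at hz
      simp only [LinearMap.mulLeft_apply] at hz
      have : x = (x - b * z) + z * b := by ring
      rw [this]
      exact Submodule.add_mem_sup hz (Ideal.mem_span_singleton'.mpr ⟨z, rfl⟩)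

lemma len_inf (A B : Ideal R) : len A + len B = len (A ⊓ B) + len (A ⊔ B) := by
  unfold len
  rw [← Module.length_prod]
  refine Module.length_eq_add_of_exact
    ((Submodule.mapQ (A ⊓ B) A LinearMap.id inf_le_left).prod
      (Submodule.mapQ (A ⊓ B) B LinearMap.id inf_le_right))
    ((Submodule.mapQ A (A ⊔ B) LinearMap.id le_sup_left).coprod
      (-Submodule.mapQ B (A ⊔ B) LinearMap.id le_sup_right)) ?_ ?_ ?_
  · rw [← LinearMap.ker_eq_bot, Submodule.eq_bot_iff]
    intro x hx
    obtain ⟨x, rfl⟩ := Submodule.Quotient.mk_surjective _ x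
    simp only [LinearMap.ker_prod, Submodule.mem_inf, LinearMap.mem_ker, Submodule.mapQ_apply,
      LinearMap.id_apply, Submodule.Quotient.mk_eq_zero] at hx
    rw [Submodule.Quotient.mk_eq_zero]
    exact hx
  · intro y
    obtain ⟨x, rfl⟩ := Submodule.Quotient.mk_surjective _ y
    exact ⟨(Submodule.Quotient.mk x, 0), by simp⟩
  · rintro ⟨x, y⟩
    obtain ⟨x, rfl⟩ := Submodule.Quotient.mk_surjective _ x
    obtain ⟨y, rfl⟩ := Submodule.Quotient.mk_surjective _ y
    simp only [LinearMap.coprod_apply, LinearMap.neg_apply, Submodule.mapQ_apply,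
      LinearMap.id_apply, ← sub_eq_add_neg]
    rw [sub_eq_zero, Submodule.Quotient.eq]
    constructor
    · intro h
      obtain ⟨a, ha, b, hb, hab⟩ := Submodule.mem_sup.mp h
      refine ⟨Submodule.Quotient.mk (x - a), ?_⟩
      simp only [LinearMap.prod_apply, Function.prod, Submodule.mapQ_apply, LinearMap.id_apply,
        Prod.mk.injEq]
      rw [Submodule.Quotient.eq, Submodule.Quotient.eq]
      constructor
      · convert neg_mem ha using 1; ring
      · have : x - a - y = b := by rw [sub_right_comm, ← hab]; ring
        rwa [this]
    · rintro ⟨z, hz⟩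
      obtain ⟨z, rfl⟩ := Submodule.Quotient.mk_surjective _ z
      simp only [LinearMap.prod_apply, Function.prod, Submodule.mapQ_apply, LinearMap.id_apply,
        Prod.mk.injEq] at hz
      rw [Submodule.Quotient.eq, Submodule.Quotient.eq] at hz
      have : x - y = -(z - x) + (z - y) := by ring
      rw [this]
      exact Submodule.add_mem_sup (neg_mem hz.1) hz.2

lemma len_pow (I : Ideal R) (y : R) (hy : ∀ z, y * z ∈ I → z ∈ I) (n : ℕ) :
    len (I ⊔ Ideal.span {y ^ n}) = n * len (I ⊔ Ideal.span {y}) := by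
  induction n with
  | zero => simp [Ideal.span_singleton_one, len_top]
  | succ n ih =>
    rw [len_cl _ y]
    have h1 : cl (I ⊔ Ideal.span {y ^ (n+1)}) y = I ⊔ Ideal.span {y ^ n} := by
      apply le_antisymm
      · intro x hx
        rw [mem_cl] at hx
        obtain ⟨a, ha, c, hc, hac⟩ := Submodule.mem_sup.mp hx
        obtain ⟨d, rfl⟩ := Ideal.mem_span_singleton'.mp hc
        have : y * (x - d * y ^ n) ∈ I := by
          convert ha using 1; rw [mul_sub, ← hac]; ring
        have := hy _ this
        rw [show x = (x - d * y ^ n) + d * y ^ n by ring]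
        exact Submodule.add_mem_sup this (Ideal.mem_span_singleton'.mpr ⟨d, rfl⟩)
      · intro x hx
        obtain ⟨a, ha, c, hc, rfl⟩ := Submodule.mem_sup.mp hx
        obtain ⟨d, rfl⟩ := Ideal.mem_span_singleton'.mp hc
        rw [mem_cl, mul_add]
        exact Submodule.add_mem_sup (I.mul_mem_left _ ha)
          (Ideal.mem_span_singleton'.mpr ⟨d, by ring⟩)
    have h2 : I ⊔ Ideal.span {y ^ (n+1)} ⊔ Ideal.span {y} = I ⊔ Ideal.span {y} := by
      rw [sup_assoc]
      congr 1
      rw [sup_eq_right, Ideal.span_singleton_le_iff_mem, Ideal.mem_span_singleton]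
      exact dvd_pow_self _ (by omega)
    rw [h1, h2, ih]
    push_cast; ring

lemma len_list [IsLocalRing R] [IsNoetherianRing R] (q : ℕ) (hq : 1 ≤ q) (L₁ : List R) :
    ∀ L₂ : List R, (∀ r ∈ L₁ ++ L₂, r ∈ IsLocalRing.maximalIdeal R) →
    RingTheory.Sequence.IsWeaklyRegular R (L₁ ++ L₂) →
    len (Ideal.ofList (L₁.map (· ^ q) ++ L₂)) = q ^ L₁.length * len (Ideal.ofList (L₁ ++ L₂)) := by
  induction L₁ with
  | nil => intro L₂ _ _; simp
  | cons x L₁ ih =>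
    intro L₂ hmem hreg
    have hperm : List.Perm (x :: L₁ ++ L₂) ((L₁ ++ L₂) ++ [x]) := by
      rw [List.cons_append]; exact (List.perm_append_singleton x (L₁ ++ L₂)).symm
    have hreg' := IsLocalRing.isWeaklyRegular_of_perm_of_subset_maximalIdeal hreg hperm hmem
    rw [RingTheory.Sequence.isWeaklyRegular_append_iff,
      RingTheory.Sequence.isWeaklyRegular_singleton_iff] at hreg'
    have hreg2 : RingTheory.Sequence.IsWeaklyRegular R (L₁ ++ (L₂ ++ [x ^ q])) := by
      rw [← List.append_assoc, RingTheory.Sequence.isWeaklyRegular_append_iff,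
        RingTheory.Sequence.isWeaklyRegular_singleton_iff]
      exact ⟨hreg'.1, hreg'.2.pow q⟩
    have hx : x ∈ IsLocalRing.maximalIdeal R := hmem x (by simp)
    have h1 := ih (L₂ ++ [x ^ q]) (by
      intro r hr
      simp only [List.mem_append, List.mem_singleton] at hr
      rcases hr with h | h | rfl
      · exact hmem r (by simp [h])
      · exact hmem r (by simp [h])
      · exact Ideal.pow_mem_of_mem _ hx q hq) hreg2
    have hy : ∀ z, x * z ∈ Ideal.ofList (L₁ ++ L₂) → z ∈ Ideal.ofList (L₁ ++ L₂) := by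
      have := hreg'.2
      rw [isSMulRegular_quotient_iff_mem_of_smul_mem] at this
      intro z hz
      have := this z (by simpa using hz)
      simpa using this
    have h2 := len_pow _ x hy q
    have e1 : Ideal.ofList ((x :: L₁).map (· ^ q) ++ L₂) = Ideal.ofList (L₁.map (· ^ q) ++ (L₂ ++ [x ^ q])) := by
      unfold Ideal.ofList; congr 1; ext r
      simp only [List.map_cons, List.cons_append, List.mem_cons, List.mem_append, Set.mem_ofPred_eq,
        List.not_mem_nil, or_false]
      tauto
    have e2 : Ideal.ofList (L₁ ++ (L₂ ++ [x ^ q])) = Ideal.ofList (L₁ ++ L₂) ⊔ Ideal.span {x ^ q} := by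
      rw [← List.append_assoc, Ideal.ofList_append, Ideal.ofList_singleton]
    have e3 : Ideal.ofList (x :: L₁ ++ L₂) = Ideal.ofList (L₁ ++ L₂) ⊔ Ideal.span {x} := by
      rw [List.cons_append, Ideal.ofList_cons, sup_comm]
    rw [e1, h1, e2, h2, e3, List.length_cons, pow_succ, mul_assoc]
end


/-! ### Part 4: flatness via lengths -/
section
variable {R : Type*} [CommRing R] [IsLocalRing R] [IsNoetherianRing R]

local notation "𝔪" => IsLocalRing.maximalIdeal R

lemma krull_mem (A : Ideal R) (x : R) (h : ∀ l : ℕ, x ∈ A ⊔ 𝔪 ^ l) : x ∈ A := by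
  have h1 := Ideal.iInf_pow_smul_eq_bot_of_isLocalRing (M := R ⧸ A) 𝔪
    (IsLocalRing.maximalIdeal.isMaximal R).ne_top
  have h2 : (Submodule.Quotient.mk x : R ⧸ A) ∈ (⨅ i : ℕ, 𝔪 ^ i • (⊤ : Submodule R (R ⧸ A))) := by
    rw [Submodule.mem_iInf]
    intro i
    obtain ⟨a, ha, c, hc, rfl⟩ := Submodule.mem_sup.mp (h i)
    rw [Submodule.Quotient.mk_add, (Submodule.Quotient.mk_eq_zero A).mpr ha, zero_add]
    have : (Submodule.Quotient.mk c : R ⧸ A) = c • Submodule.Quotient.mk 1 := by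
      rw [← Submodule.Quotient.mk_smul, smul_eq_mul, mul_one]
    rw [this]
    exact Submodule.smul_mem_smul hc trivial
  rw [h1, Submodule.mem_bot] at h2
  exact (Submodule.Quotient.mk_eq_zero A).mp h2

lemma krull_le (A B : Ideal R) (h : ∀ l : ℕ, B ≤ A ⊔ 𝔪 ^ l) : B ≤ A :=
  fun x hx => krull_mem A x fun l => h l hx

lemma chevalley [IsAdicComplete 𝔪 R] (hfin : ∀ n : ℕ, len (𝔪 ^ n) ≠ ⊤)
    (F : Set (Ideal R)) (hne : F.Nonempty)
    (hdir : ∀ A ∈ F, ∀ B ∈ F, ∃ C ∈ F, C ≤ A ⊓ B) (l : ℕ) :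
    ∃ I ∈ F, I ≤ sInf F ⊔ 𝔪 ^ l := by
  classical
  have key : ∀ l : ℕ, ∃ I ∈ F, ∀ I' ∈ F, I ⊔ 𝔪 ^ l ≤ I' ⊔ 𝔪 ^ l := by
    intro l
    have hb : ∀ I : Ideal R, len (I ⊔ 𝔪 ^ l) ≠ ⊤ := fun I h =>
      hfin l (top_le_iff.mp (h ▸ len_mono le_sup_right))
    let g : Ideal R → ℕ := fun I => (len (I ⊔ 𝔪 ^ l)).toNat
    have hg : ∀ I, (g I : ℕ∞) = len (I ⊔ 𝔪 ^ l) := fun I => ENat.natCast_toNat (hb I)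
    have hbd : ∀ I, g I ≤ (len (𝔪 ^ l)).toNat := fun I =>
      ENat.toNat_le_toNat (len_mono le_sup_right) (hfin l)
    obtain ⟨I, hI, hmax⟩ : ∃ I ∈ F, ∀ I' ∈ F, g I' ≤ g I := by
      have hfs : (g '' F).Finite := (Set.finite_Iic _).subset (by rintro _ ⟨I, _, rfl⟩; exact hbd I)
      obtain ⟨_, ⟨⟨I, hI, rfl⟩, h⟩⟩ := hfs.exists_maximal (hne.image g)
      refine ⟨I, hI, fun I' hI' => ?_⟩
      by_contra hc
      exact hc (h ⟨I', hI', rfl⟩ (by omega))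
    refine ⟨I, hI, fun I' hI' => ?_⟩
    obtain ⟨C, hC, hCl⟩ := hdir I hI I' hI'
    have e : C ⊔ 𝔪 ^ l = I ⊔ 𝔪 ^ l := by
      apply len_eq (sup_le_sup_right (hCl.trans inf_le_left) _) _ (hb C)
      rw [← hg, ← hg]
      exact_mod_cast hmax C hC
    rw [← e]
    exact sup_le_sup_right (hCl.trans inf_le_right) _
  choose I hI hmin using key
  refine ⟨I l, hI l, fun x hx => ?_⟩
  -- build the Cauchy sequence
  have step : ∀ k : ℕ, ∀ z : R, ∃ z' : R, z ∈ I (l + k) ⊔ 𝔪 ^ (l + k) →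
      (z' ∈ I (l + (k+1)) ⊔ 𝔪 ^ (l + (k+1)) ∧ z' - z ∈ 𝔪 ^ (l + k)) := by
    intro k z
    by_cases hz : z ∈ I (l + k) ⊔ 𝔪 ^ (l + k)
    · have hz' := hmin (l+k) _ (hI (l + (k+1))) hz
      obtain ⟨a, ha, c, hc, rfl⟩ := Submodule.mem_sup.mp hz'
      refine ⟨a, fun _ => ⟨Submodule.mem_sup_left ha, ?_⟩⟩
      convert neg_mem hc using 1; ring
    · exact ⟨0, fun h => absurd h hz⟩
  choose nx hnx using step
  let s : ℕ → R := fun k => Nat.rec x (fun k z => nx k z) k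
  have hs0 : s 0 = x := rfl
  have hss : ∀ k, s (k+1) = nx k (s k) := fun k => rfl
  have hsm : ∀ k, s k ∈ I (l + k) ⊔ 𝔪 ^ (l + k) := by
    intro k
    induction k with
    | zero => exact Submodule.mem_sup_left hx
    | succ k ih => rw [hss]; exact (hnx k _ ih).1
  have hsd : ∀ k, s (k+1) - s k ∈ 𝔪 ^ (l + k) := fun k => by rw [hss]; exact (hnx k _ (hsm k)).2
  have hsd2 : ∀ k j, s (k + j) - s k ∈ 𝔪 ^ (l + k) := by
    intro k j
    induction j with
    | zero => simp
    | succ j ih =>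
      have := add_mem (Ideal.pow_le_pow_right (show l + k ≤ l + (k + j) by omega) (hsd (k+j))) ih
      convert this using 1
      rw [← add_assoc]; ring
  obtain ⟨y, hy⟩ := IsPrecomplete.prec' (I := 𝔪) (M := R) s (by
    intro a b hab
    rw [SModEq.sub_mem]
    obtain ⟨j, rfl⟩ := Nat.exists_eq_add_of_le hab
    have := neg_mem (hsd2 a j)
    rw [neg_sub] at this
    simpa using Ideal.pow_le_pow_right (show a ≤ l + a by omega) this)
  have hy' : ∀ n, s n - y ∈ 𝔪 ^ n := by
    intro n
    have := hy n
    rw [SModEq.sub_mem] at this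
    simpa using this
  have hyJ : y ∈ sInf F := by
    rw [Submodule.mem_sInf]
    intro A hA
    apply krull_mem
    intro j
    have h1 : s j ∈ A ⊔ 𝔪 ^ j := by
      have := hmin (l + j) A hA (hsm j)
      have h3 : (𝔪 ^ (l + j) : Ideal R) ≤ 𝔪 ^ j := Ideal.pow_le_pow_right (by omega)
      exact (sup_le_sup_left h3 A) this
    have h2 := sub_mem h1 (Submodule.mem_sup_right (hy' j) : s j - y ∈ A ⊔ 𝔪 ^ j)
    simpa using h2
  have hyx : x - y ∈ 𝔪 ^ l := by
    have h1 := hsd2 0 l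
    have h2 := hy' l
    rw [zero_add, hs0, add_zero] at h1
    have := sub_mem h2 h1
    convert this using 1; ring
  rw [show x = y + (x - y) by ring]
  exact Submodule.add_mem_sup hyJ hyx

/-- the hypotheses making an endomorphism flat in our elementary sense -/
structure GoodHom (f : R →+* R) : Prop where
  loc : (𝔪).map f ≤ 𝔪
  fin : len ((𝔪).map f) ≠ ⊤
  prim : ∀ n : ℕ, ∃ M : Ideal R, M ≤ 𝔪 ^ n ∧ (∃ k, 𝔪 ^ k ≤ M) ∧ len M ≠ ⊤ ∧ len (M.map f) = len ((𝔪).map f) * len M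

namespace GoodHom
variable {f : R →+* R}

lemma fin_pow (hf : GoodHom f) (n : ℕ) : len (𝔪 ^ n) ≠ ⊤ := by
  obtain ⟨M, h1, _, h2, _⟩ := hf.prim n
  exact fun h => h2 (top_le_iff.mp (h ▸ len_mono h1))

lemma fin_of_le (hf : GoodHom f) {n : ℕ} {A : Ideal R} (h : 𝔪 ^ n ≤ A) : len A ≠ ⊤ :=
  fun h' => hf.fin_pow n (top_le_iff.mp (h' ▸ len_mono h))

lemma _root_.one_le_len {A : Ideal R} (h : A ≠ ⊤) : 1 ≤ len A := by
  rw [Order.one_le_iff_ne_zero]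
  unfold len
  intro h'
  rw [Module.length_eq_zero_iff] at h'
  exact h (Ideal.Quotient.subsingleton_iff.mp h')

lemma submul (hf : GoodHom f) (n : ℕ) (N : ℕ) : ∀ A B : Ideal R, A ≤ B → 𝔪 ^ n ≤ A → len A ≤ N →
    len (A.map f) + len ((𝔪).map f) * len B ≤ len (B.map f) + len ((𝔪).map f) * len A := by
  classical
  induction N with
  | zero =>
    intro A B hAB hA hN
    have : A = ⊤ := by
      by_contra h
      have := (one_le_len h).trans hN
      simp at this
    have hB : B = ⊤ := top_le_iff.mp (this ▸ hAB)
    rw [this, hB]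
  | succ N ih =>
    intro A B hAB hA hN
    by_cases hBA : B ≤ A
    · rw [le_antisymm hAB hBA]
    have hex : ∃ k, B * 𝔪 ^ k ≤ A := ⟨n, (Ideal.mul_le_right : B * 𝔪 ^ n ≤ 𝔪 ^ n).trans hA⟩
    obtain ⟨k, hk⟩ : ∃ k, Nat.find hex = k + 1 := Nat.exists_eq_succ_of_ne_zero (by
      intro h
      have := Nat.find_spec hex
      rw [h, pow_zero, mul_one] at this
      exact hBA this)
    have h1 := Nat.find_spec hex
    rw [hk, pow_succ, ← mul_assoc] at h1
    have h2 := Nat.find_min hex (m := k) (by omega)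
    obtain ⟨b, hb, hbA⟩ := SetLike.not_le_iff_exists.mp h2
    have hmb : 𝔪 ≤ cl A b := fun x hx => h1 (Ideal.mul_mem_mul hb hx)
    have hbB : b ∈ B := (Ideal.mul_le_left : B * 𝔪 ^ k ≤ B) hb
    have hcl : cl A b ≠ ⊤ := fun h => hbA (by
      have : (1 : R) ∈ cl A b := h ▸ trivial
      simpa [mem_cl] using this)
    have e1 := len_cl A b
    have e2 := len_cl (A.map f) (f b)
    have e3 : A.map f ⊔ Ideal.span {f b} = (A ⊔ Ideal.span {b}).map f := by
      rw [Ideal.map_sup, Ideal.map_span, Set.image_singleton]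
    rw [e3] at e2
    have hAfin := hf.fin_of_le hA
    set A' := A ⊔ Ideal.span {b} with hA'
    have hA'fin := hf.fin_of_le (hA.trans (le_sup_left : A ≤ A'))
    have e4 : len A' + 1 ≤ len A := by
      rw [e1, add_comm]
      gcongr
      exact one_le_len hcl
    have e5 := ih A' B (sup_le hAB (by rwa [Ideal.span_singleton_le_iff_mem]))
      (hA.trans le_sup_left) (by
        have := e4.trans hN
        push_cast at this
        exact (ENat.add_le_add_iff_right (by simp)).mp this)
    have e6 : len (cl (A.map f) (f b)) ≤ len ((𝔪).map f) := by
      apply len_mono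
      rw [Ideal.map_le_iff_le_comap]
      intro x hx
      rw [Ideal.mem_comap, mem_cl, ← map_mul]
      exact Ideal.mem_map_of_mem f (hmb hx)
    calc len (A.map f) + len ((𝔪).map f) * len B
        = len (cl (A.map f) (f b)) + (len (A'.map f) + len ((𝔪).map f) * len B) := by
          rw [e2, add_assoc]
      _ ≤ len ((𝔪).map f) + (len (B.map f) + len ((𝔪).map f) * len A') := by gcongr
      _ = len (B.map f) + len ((𝔪).map f) * (len A' + 1) := by ring
      _ ≤ _ := by gcongr

lemma mult (hf : GoodHom f) {n : ℕ} {A : Ideal R} (hA : 𝔪 ^ n ≤ A) :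
    len (A.map f) = len ((𝔪).map f) * len A := by
  have hsub : ∀ (n : ℕ) (A B : Ideal R), A ≤ B → 𝔪 ^ n ≤ A →
    len (A.map f) + len ((𝔪).map f) * len B ≤ len (B.map f) + len ((𝔪).map f) * len A := by
    intro n A B hAB hA
    exact hf.submul n (len A).toNat A B hAB hA (by rw [ENat.natCast_toNat (hf.fin_of_le hA)])
  apply le_antisymm
  · have := hsub n A ⊤ le_top hA
    simpa [len_top, Ideal.map_top] using this
  · obtain ⟨M, hM, ⟨k, hk⟩, hMf, hMe⟩ := hf.prim n
    have := hsub k M A (hM.trans hA) hk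
    rw [← hMe, add_comm] at this
    refine (ENat.add_le_add_iff_right ?_).mp this
    rw [hMe]
    exact WithTop.mul_ne_top hf.fin hMf


lemma fin_map (hf : GoodHom f) {n : ℕ} {A : Ideal R} (hA : 𝔪 ^ n ≤ A) : len (A.map f) ≠ ⊤ := by
  rw [hf.mult hA]
  exact WithTop.mul_ne_top hf.fin (hf.fin_of_le hA)

lemma le_cl (A : Ideal R) (b : R) : A ≤ cl A b := fun _ hx => A.mul_mem_left _ hx

lemma map_cl_le (f : R →+* R) (A : Ideal R) (b : R) : (cl A b).map f ≤ cl (A.map f) (f b) := by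
  rw [Ideal.map_le_iff_le_comap]
  intro x hx
  rw [Ideal.mem_comap, mem_cl, ← map_mul]
  exact Ideal.mem_map_of_mem f hx

lemma cl_prim (hf : GoodHom f) {n : ℕ} {A : Ideal R} (hA : 𝔪 ^ n ≤ A) (b : R) :
    cl (A.map f) (f b) = (cl A b).map f := by
  have h1 := le_cl A b
  symm
  apply len_eq (map_cl_le f A b) _ (hf.fin_map (hA.trans h1))
  have e1 := len_cl A b
  have e2 := len_cl (A.map f) (f b)
  have e3 : A.map f ⊔ Ideal.span {f b} = (A ⊔ Ideal.span {b}).map f := by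
    rw [Ideal.map_sup, Ideal.map_span, Set.image_singleton]
  have hA' : 𝔪 ^ n ≤ A ⊔ Ideal.span {b} := hA.trans le_sup_left
  rw [e3, hf.mult hA, e1, mul_add, ← hf.mult hA', ← hf.mult (hA.trans h1)] at e2
  exact ((ENat.add_le_add_iff_right (hf.fin_map hA')).mp e2.le)

lemma inf_prim (hf : GoodHom f) {n : ℕ} {A B : Ideal R} (hA : 𝔪 ^ n ≤ A) (hB : 𝔪 ^ n ≤ B) :
    A.map f ⊓ B.map f = (A ⊓ B).map f := by
  symm
  apply len_eq (le_inf (Ideal.map_mono inf_le_left) (Ideal.map_mono inf_le_right)) _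
    (hf.fin_map (le_inf hA hB))
  have e1 := len_inf A B
  have e2 := len_inf (A.map f) (B.map f)
  have hS : 𝔪 ^ n ≤ A ⊔ B := hA.trans le_sup_left
  rw [← Ideal.map_sup, hf.mult hA, hf.mult hB, ← mul_add, e1, mul_add, ← hf.mult hS,
    ← hf.mult (le_inf hA hB)] at e2
  exact ((ENat.add_le_add_iff_right (hf.fin_map hS)).mp e2.le)

lemma map_pow_le (hf : GoodHom f) (n : ℕ) : (𝔪 ^ n).map f ≤ 𝔪 ^ n := by
  rw [Ideal.map_pow]
  exact Ideal.pow_right_mono hf.loc n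

/-- if a family has infimum `J`, then elements of all `I.map f` lie in `J.map f`. -/
lemma directed_inf [IsAdicComplete 𝔪 R] (hf : GoodHom f) (F : Set (Ideal R)) (hne : F.Nonempty)
    (hdir : ∀ A ∈ F, ∀ B ∈ F, ∃ C ∈ F, C ≤ A ⊓ B) (X : Ideal R) (hX : ∀ I ∈ F, X ≤ I.map f) :
    X ≤ (sInf F).map f := by
  apply krull_le
  intro l
  obtain ⟨I, hI, hl⟩ := chevalley hf.fin_pow F hne hdir l
  refine (hX I hI).trans ((Ideal.map_mono hl).trans ?_)
  rw [Ideal.map_sup]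
  exact sup_le_sup_left (hf.map_pow_le l) _

lemma directed_inf_seq [IsAdicComplete 𝔪 R] (hf : GoodHom f) (F : ℕ → Ideal R) (hF : Antitone F)
    (X : Ideal R) (hX : ∀ n, X ≤ (F n).map f) :
    X ≤ (⨅ n, F n).map f := by
  refine hf.directed_inf (Set.range F) (Set.range_nonempty _) ?_ X ?_
  · rintro _ ⟨a, rfl⟩ _ ⟨b, rfl⟩
    exact ⟨F (max a b), ⟨_, rfl⟩, le_inf (hF (le_max_left _ _)) (hF (le_max_right _ _))⟩
  · rintro _ ⟨a, rfl⟩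
    exact hX a

lemma cl_map [IsAdicComplete 𝔪 R] (hf : GoodHom f) (A : Ideal R) (b : R) :
    cl (A.map f) (f b) = (cl A b).map f := by
  apply le_antisymm _ (map_cl_le f A b)
  have e : cl A b = ⨅ n : ℕ, cl (A ⊔ 𝔪 ^ n) b := by
    apply le_antisymm
    · exact le_iInf fun n x hx => Submodule.mem_sup_left hx
    · intro x hx
      rw [Submodule.mem_iInf] at hx
      exact krull_mem A (b * x) hx
  rw [e]
  refine hf.directed_inf_seq _ ?_ _ ?_
  · intro a b' hab x hx
    exact (sup_le_sup_left (Ideal.pow_le_pow_right hab) A) hx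
  · intro n
    rw [← hf.cl_prim (n := n) le_sup_right]
    have h1 : A.map f ≤ (A ⊔ 𝔪 ^ n).map f := Ideal.map_mono le_sup_left
    exact fun x hx => mem_cl.mpr (h1 (mem_cl.mp hx))

lemma inf_map [IsAdicComplete 𝔪 R] (hf : GoodHom f) (A B : Ideal R) :
    A.map f ⊓ B.map f ≤ (A ⊓ B).map f := by
  have e : A ⊓ B = ⨅ n : ℕ, (A ⊔ 𝔪 ^ n) ⊓ (B ⊔ 𝔪 ^ n) := by
    apply le_antisymm
    · exact le_iInf fun n => inf_le_inf le_sup_left le_sup_left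
    · refine le_inf (krull_le _ _ fun l => ?_) (krull_le _ _ fun l => ?_)
      · exact (iInf_le _ l).trans inf_le_left
      · exact (iInf_le _ l).trans inf_le_right
  rw [e]
  refine hf.directed_inf_seq _ ?_ _ ?_
  · intro a b hab
    have : (𝔪 ^ b : Ideal R) ≤ 𝔪 ^ a := Ideal.pow_le_pow_right hab
    exact inf_le_inf (sup_le_sup_left this _) (sup_le_sup_left this _)
  · intro n
    rw [← hf.inf_prim (n := n) le_sup_right le_sup_right]
    exact inf_le_inf (Ideal.map_mono le_sup_left) (Ideal.map_mono le_sup_left)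

/-- condition (*) -/
lemma star [IsAdicComplete 𝔪 R] (hf : GoodHom f) (a : Ideal R) :
    a ≤ (sInf {I : Ideal R | a ≤ I.map f}).map f := by
  refine hf.directed_inf _ ⟨⊤, ?_⟩ ?_ _ (fun I hI => hI)
  · change a ≤ _
    rw [Ideal.map_top]; exact le_top
  · intro A hA B hB
    exact ⟨A ⊓ B, (le_inf hA hB).trans (hf.inf_map A B), le_rfl⟩

end GoodHom
end


section
variable {R : Type*} [CommRing R] [IsLocalRing R] [IsNoetherianRing R]

lemma len_max : len (IsLocalRing.maximalIdeal R) = 1 := by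
  unfold len
  rw [Module.length_eq_one_iff, isSimpleModule_iff_isCoatom]
  exact Ideal.isMaximal_def.mp (IsLocalRing.maximalIdeal.isMaximal R)

theorem goodHom_frob (p : ℕ) (hp : p.Prime) [ExpChar R p] (hreg : IsRegularStmt R) (e : ℕ) :
    GoodHom (iterateFrobenius R p e) := by
  classical
  obtain ⟨s, hs, hd⟩ := hreg
  set m := IsLocalRing.maximalIdeal R with hm
  let L := s.toList
  have hL : Ideal.ofList L = m := by rw [hs]; simp [Ideal.ofList, L]
  have hw : RingTheory.Sequence.IsWeaklyRegular R L := reg_seq L hL (by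
    rw [Finset.length_toList]; exact hd.le)
  have hlen : ∀ e : ℕ, len (m.map (iterateFrobenius R p e)) = ((p ^ e : ℕ) : ℕ∞) ^ L.length := by
    intro e
    have h1 := len_list (p ^ e) (pow_pos hp.pos e) L [] (by
      intro r hr
      rw [List.append_nil] at hr
      rw [← hm, ← hL]
      exact Ideal.subset_span hr) (by rwa [List.append_nil])
    rw [List.append_nil, List.append_nil, hL, len_max, mul_one] at h1
    rw [← hL, Ideal.map_ofList, ← h1]
    congr 2
  have hfin : ∀ e : ℕ, len (m.map (iterateFrobenius R p e)) ≠ ⊤ := by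
    intro e
    rw [hlen]
    exact_mod_cast ENat.natCast_ne_top ((p ^ e) ^ L.length)
  have hle : ∀ e : ℕ, m.map (iterateFrobenius R p e) ≤ m ^ (p ^ e) := by
    intro e
    rw [Ideal.map_le_iff_le_comap]
    intro x hx
    rw [Ideal.mem_comap, iterateFrobenius_def]
    exact Ideal.pow_mem_pow hx _
  refine ⟨(hle e).trans (Ideal.pow_le_self (pow_ne_zero _ hp.pos.ne')), hfin e, fun n => ?_⟩
  refine ⟨m.map (iterateFrobenius R p n), (hle n).trans (Ideal.pow_le_pow_right
    (Nat.lt_pow_self hp.one_lt).le), ?_, hfin n, ?_⟩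
  · apply Ideal.exists_pow_le_of_le_radical_of_fg _ (IsNoetherian.noetherian m)
    intro x hx
    exact ⟨p ^ n, by
      rw [← iterateFrobenius_def]
      exact Ideal.mem_map_of_mem _ hx⟩
  · rw [Ideal.map_map, ← iterateFrobenius_add, hlen, hlen, hlen, pow_add]
    push_cast
    rw [mul_pow]
end


/-! ### Part 5: the left adjoint of `J ↦ J.map f` and stabilization of chains -/
/-- left adjoint to `Ideal.map f` -/
def adj {R : Type*} [CommRing R] (f : R →+* R) (a : Ideal R) : Ideal R :=
  sInf {I : Ideal R | a ≤ I.map f}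

lemma loc_chain {R : Type*} [CommRing R] [IsNoetherianRing R] (K P : Ideal R) [P.IsPrime]
    (hP : P ∈ K.minimalPrimes) (J : ℕ → Ideal R) (hJ : Antitone J) :
    ∃ s, ∃ c, c ∉ P ∧ ∀ x ∈ J s, c * x ∈ J (s + 1) ⊔ K := by
  classical
  let A := Localization.AtPrime P
  let φ := algebraMap R A
  have hart : IsArtinianRing (A ⧸ K.map φ) := by
    apply IsLocalRing.quotient_artinian_of_mem_minimalPrimes_of_isLocalRing
    rwa [IsLocalization.minimalPrimes_map P.primeCompl A K,
      Set.mem_preimage, Localization.AtPrime.under_maximalIdeal]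
  let qs : ℕ →o (Ideal (A ⧸ K.map φ))ᵒᵈ :=
    { toFun n := OrderDual.toDual (((J n).map φ).map (Ideal.Quotient.mk (K.map φ)))
      monotone' i j e := Ideal.map_mono (Ideal.map_mono (hJ e)) }
  obtain ⟨s, hs⟩ := IsArtinian.monotone_stabilizes qs
  have h1 : ((J s).map φ).map (Ideal.Quotient.mk (K.map φ))
      = ((J (s+1)).map φ).map (Ideal.Quotient.mk (K.map φ)) := hs (s+1) (by omega)
  have h2 : ∀ x ∈ J s, ∃ c, c ∉ P ∧ c * x ∈ J (s + 1) ⊔ K := by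
    intro x hx
    have h3 : φ x ∈ (J (s+1) ⊔ K).map φ := by
      have : Ideal.Quotient.mk (K.map φ) (φ x) ∈
          ((J (s+1)).map φ).map (Ideal.Quotient.mk (K.map φ)) := by
        rw [← h1]
        exact Ideal.mem_map_of_mem _ (Ideal.mem_map_of_mem _ hx)
      rw [← Ideal.mem_comap, Ideal.comap_map_of_surjective _ Ideal.Quotient.mk_surjective,
        ← RingHom.ker_eq_comap_bot, Ideal.mk_ker, ← Ideal.map_sup] at this
      exact this
    obtain ⟨c, hc, hcx⟩ := (IsLocalization.algebraMap_mem_map_algebraMap_iff P.primeCompl A _ _).mp h3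
    exact ⟨c, hc, hcx⟩
  obtain ⟨t, ht⟩ := IsNoetherian.noetherian (J s)
  have h3 : ∀ x : R, ∃ c, x ∈ t → c ∉ P ∧ c * x ∈ J (s + 1) ⊔ K := by
    intro x
    by_cases hx : x ∈ t
    · obtain ⟨c, hc⟩ := h2 x (ht ▸ Submodule.subset_span hx)
      exact ⟨c, fun _ => hc⟩
    · exact ⟨0, fun h => absurd h hx⟩
  choose c hc using h3
  refine ⟨s, ∏ x ∈ t, c x, ?_, ?_⟩
  · intro h
    obtain ⟨x, hx, hxP⟩ := (Ideal.IsPrime.prod_mem_iff (hp := ‹P.IsPrime›)).mp h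
    exact (hc x hx).1 hxP
  · have : J s ≤ cl (J (s+1) ⊔ K) (∏ x ∈ t, c x) := by
      rw [← ht]
      refine Submodule.span_le.mpr ?_
      intro x hx
      have hx' : x ∈ t := hx
      rw [SetLike.mem_coe, mem_cl, ← Finset.mul_prod_erase t c hx', mul_right_comm]
      exact Ideal.mul_mem_right _ _ (hc x hx').2
    exact this

section
variable {R : Type*} [CommRing R] [IsLocalRing R] [IsNoetherianRing R]
  [IsAdicComplete (IsLocalRing.maximalIdeal R) R] {f : R →+* R}

namespace GoodHom

lemma adj_le (hf : GoodHom f) {a J : Ideal R} : adj f a ≤ J ↔ a ≤ J.map f :=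
  ⟨fun h => (hf.star a).trans (Ideal.map_mono h), fun h => sInf_le h⟩

lemma adj_mono (hf : GoodHom f) {a b : Ideal R} (h : a ≤ b) : adj f a ≤ adj f b :=
  hf.adj_le.mpr (h.trans (hf.adj_le.mp le_rfl))

lemma adj_sup (hf : GoodHom f) (a b : Ideal R) : adj f (a ⊔ b) = adj f a ⊔ adj f b := by
  apply le_antisymm
  · rw [hf.adj_le, Ideal.map_sup]
    exact sup_le_sup (hf.adj_le.mp le_rfl) (hf.adj_le.mp le_rfl)
  · exact sup_le (hf.adj_mono le_sup_left) (hf.adj_mono le_sup_right)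

lemma adj_top (hf : GoodHom f) : adj f ⊤ = ⊤ := by
  by_contra h
  have h1 := IsLocalRing.le_maximalIdeal h
  rw [hf.adj_le] at h1
  exact (IsLocalRing.maximalIdeal.isMaximal R).ne_top (top_le_iff.mp (h1.trans hf.loc))

lemma adj_mul (hf : GoodHom f) (x : R) (A : Ideal R) :
    adj f (Ideal.span {f x} * A) = Ideal.span {x} * adj f A := by
  apply le_antisymm
  · rw [hf.adj_le, Ideal.map_mul, Ideal.map_span, Set.image_singleton]
    exact Ideal.mul_mono_right (hf.adj_le.mp le_rfl)
  · have h1 : adj f A ≤ cl (adj f (Ideal.span {f x} * A)) x := by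
      rw [hf.adj_le, ← hf.cl_map]
      intro y hy
      rw [mem_cl]
      exact (hf.adj_le.mp le_rfl) (Ideal.mul_mem_mul (Ideal.mem_span_singleton_self _) hy)
    rw [Ideal.span_singleton_mul_le_iff]
    exact fun z hz => h1 hz

/-- The Hartshorne–Speiser–Lyubeznik type stabilization -/
theorem stab (hf : GoodHom f) (q : ℕ) (hq : 2 ≤ q) (hfq : ∀ x, f x = x ^ q) (u : R)
    (J : ℕ → Ideal R) (h0 : J 0 = ⊤) (hs : ∀ s, J (s + 1) = adj f (Ideal.span {u} * J s)) :
    ∃ s, ∀ t, s ≤ t → J t = J s := by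
  classical
  set C : Ideal R → Ideal R := fun X => adj f (Ideal.span {u} * X) with hC
  have hCle : ∀ {X Y : Ideal R}, C X ≤ Y ↔ X ≤ cl (Y.map f) u := by
    intro X Y
    rw [hC, hf.adj_le, Ideal.span_singleton_mul_le_iff]
    exact Iff.rfl
  have hCmono : ∀ {X Y : Ideal R}, X ≤ Y → C X ≤ C Y := fun h => hf.adj_mono (Ideal.mul_mono_right h)
  have hCsup : ∀ X Y : Ideal R, C (X ⊔ Y) = C X ⊔ C Y := by
    intro X Y
    simp only [hC]
    rw [Ideal.mul_sup, hf.adj_sup]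
  have hCmul : ∀ (c : R) (X : Ideal R), C (Ideal.span {c ^ q} * X) = Ideal.span {c} * C X := by
    intro c X
    simp only [hC]
    rw [← hf.adj_mul, hfq, mul_left_comm]
  have hJs : ∀ s, J (s+1) = C (J s) := hs
  have hanti : Antitone J := by
    apply antitone_nat_of_succ_le
    intro n
    induction n with
    | zero => rw [h0]; exact le_top
    | succ n ih => exact ((hJs (n+1)).le.trans (hCmono ih)).trans (hJs n).ge
  set J' := ⨅ n, J n with hJ'
  have hJ'le : ∀ n, J' ≤ J n := iInf_le _
  have hCJ' : J' ≤ cl (J'.map f) u := by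
    have : Ideal.span {u} * J' ≤ J'.map f := by
      conv_rhs => rw [hJ']
      refine hf.directed_inf_seq J hanti _ fun n => ?_
      rw [← hf.adj_le]
      exact le_trans (le_trans (hCmono (hJ'le n)) (hJs n).ge) (hanti (by omega))
    rwa [← hCle, hC, hf.adj_le]
  -- the ascending chain
  let Ks : ℕ → Ideal R := fun n => Nat.rec J' (fun _ X => cl (X.map f) u) n
  have hK0 : Ks 0 = J' := rfl
  have hKs : ∀ n, Ks (n+1) = cl ((Ks n).map f) u := fun n => rfl
  have hclmono : ∀ {X Y : Ideal R}, X ≤ Y → cl (X.map f) u ≤ cl (Y.map f) u :=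
    fun h x hx => mem_cl.mpr ((Ideal.map_mono h) (mem_cl.mp hx))
  have hKmono : Monotone Ks := by
    apply monotone_nat_of_le_succ
    intro n
    induction n with
    | zero => exact hCJ'
    | succ n ih => rw [hKs (n+1), hKs n]; exact hclmono ih
  obtain ⟨n, hn⟩ := monotone_stabilizes_iff_noetherian.mpr ‹IsNoetherianRing R› ⟨Ks, hKmono⟩
  have hn' : Ks n = Ks (n+1) := hn (n+1) (by omega)
  set K := Ks n with hK
  have hJK : J' ≤ K := hKmono (Nat.zero_le n)
  have hKiff : ∀ {X : Ideal R}, C X ≤ K ↔ X ≤ K := by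
    intro X
    rw [hCle]
    rw [hK, ← hKs n, ← hn']
  rcases eq_or_ne K ⊤ with hKtop | hKtop
  · have : ∀ i ≤ n, J i ≤ Ks (n - i) := by
      intro i
      induction i with
      | zero => intro _; rw [Nat.sub_zero, ← hK, hKtop]; exact le_top
      | succ i ih =>
        intro hi
        have h1 := ih (by omega)
        rw [show n - i = (n - (i+1)) + 1 by omega, hKs, ← hCle] at h1
        rw [hJs]; exact h1
    have h2 := this n le_rfl
    rw [Nat.sub_self, hK0] at h2
    exact ⟨n, fun t ht => le_antisymm (hanti ht) (h2.trans (hJ'le t))⟩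
  · exfalso
    obtain ⟨P, hP⟩ := Ideal.nonempty_minimalPrimes hKtop
    have hPp : P.IsPrime := hP.1.1
    have hKP : K ≤ P := hP.1.2
    obtain ⟨s, c, hc, hcJ⟩ := loc_chain K P hP J hanti
    have hcJ' : Ideal.span {c} * J s ≤ J (s+1) ⊔ K := by
      rw [Ideal.span_singleton_mul_le_iff]; exact hcJ
    have hind : ∀ j, Ideal.span {c ^ 2} * J s ≤ J (s + j) ⊔ K := by
      intro j
      induction j with
      | zero => exact (Ideal.mul_le_right : Ideal.span {c ^ 2} * J s ≤ J s).trans le_sup_left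
      | succ j ih =>
        have e1 : Ideal.span {c ^ 2} * J s = Ideal.span {c} * (Ideal.span {c} * J s) := by
          rw [← mul_assoc, Ideal.span_singleton_mul_span_singleton, sq]
        have e2 : Ideal.span {c} * J (s+1) ≤ J (s + (j+1)) ⊔ K := by
          rw [hJs, ← hCmul, ← add_assoc, hJs (s+j)]
          calc C (Ideal.span {c ^ q} * J s) ≤ C (Ideal.span {c ^ 2} * J s) := by
                apply hCmono
                apply Ideal.mul_mono_left
                rw [Ideal.span_singleton_le_span_singleton]
                exact pow_dvd_pow c hq
            _ ≤ C (J (s + j) ⊔ K) := hCmono ih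
            _ = C (J (s + j)) ⊔ C K := hCsup _ _
            _ ≤ _ := sup_le_sup_left (hKiff.mpr le_rfl) _
        rw [e1]
        calc Ideal.span {c} * (Ideal.span {c} * J s) ≤ Ideal.span {c} * (J (s+1) ⊔ K) :=
              Ideal.mul_mono_right hcJ'
          _ = Ideal.span {c} * J (s+1) ⊔ Ideal.span {c} * K := Ideal.mul_sup _ _ _
          _ ≤ _ := sup_le e2 ((Ideal.mul_le_right : Ideal.span {c} * K ≤ K).trans le_sup_right)
    have hall : Ideal.span {c ^ 2} * J s ≤ K := by
      apply krull_le
      intro l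
      obtain ⟨_, ⟨t, rfl⟩, hl⟩ := chevalley hf.fin_pow (Set.range J) (Set.range_nonempty _) (by
        rintro _ ⟨a, rfl⟩ _ ⟨b, rfl⟩
        exact ⟨J (max a b), ⟨_, rfl⟩, le_inf (hanti (le_max_left _ _)) (hanti (le_max_right _ _))⟩) l
      have hl' : J t ≤ J' ⊔ IsLocalRing.maximalIdeal R ^ l := hl
      refine (hind t).trans (sup_le ?_ le_sup_left)
      exact ((hanti (by omega)).trans hl').trans (sup_le_sup_right hJK _)
    have hback : ∀ i ≤ s, ∃ N, Ideal.span {c ^ N} * J (s - i) ≤ K := by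
      intro i
      induction i with
      | zero => intro _; exact ⟨2, hall⟩
      | succ i ih =>
        intro hi
        obtain ⟨N, hN⟩ := ih (by omega)
        refine ⟨N * q, ?_⟩
        rw [← hKiff, pow_mul, hCmul, ← hJs, show s - (i+1) + 1 = s - i by omega]
        exact hN
    obtain ⟨N, hN⟩ := hback s le_rfl
    rw [Nat.sub_self, h0, Ideal.mul_top, Ideal.span_singleton_le_iff_mem] at hN
    exact hc (hPp.mem_of_pow_mem _ (hKP hN))

end GoodHom
end


/-! ### Part 6: test ideals of principal ideals -/
section
variable {R : Type*} [CommRing R] [IsLocalRing R] [IsNoetherianRing R]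
  [IsAdicComplete (IsLocalRing.maximalIdeal R) R]

lemma adj_adj {f h : R →+* R} (hf : GoodHom f) (hh : GoodHom h) (hfh : GoodHom (f.comp h))
    (a : Ideal R) : adj h (adj f a) = adj (f.comp h) a := by
  have key : ∀ J, adj h (adj f a) ≤ J ↔ adj (f.comp h) a ≤ J := by
    intro J
    rw [hh.adj_le, hf.adj_le, hfh.adj_le, Ideal.map_map]
  exact le_antisymm ((key _).mpr le_rfl) ((key _).mp le_rfl)

/-- the ideals `I_e(g^n)` -/
def IGe (p : ℕ) [ExpChar R p] (g : R) (e n : ℕ) : Ideal R :=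
  adj (iterateFrobenius R p e) (Ideal.span {g ^ n})

variable (p : ℕ) [ExpChar R p] (hG : ∀ e, GoodHom (iterateFrobenius R p e)) (g : R)
include hG

lemma adj_frob (e f : ℕ) (a : Ideal R) :
    adj (iterateFrobenius R p e) (adj (iterateFrobenius R p f) a)
      = adj (iterateFrobenius R p (f + e)) a := by
  have h := hG (f + e)
  rw [iterateFrobenius_add] at h ⊢
  exact adj_adj (hG f) (hG e) h a

lemma IGe_anti (e : ℕ) {n n' : ℕ} (h : n ≤ n') : IGe p g e n' ≤ IGe p g e n := by
  apply (hG e).adj_mono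
  rw [Ideal.span_singleton_le_span_singleton]
  exact pow_dvd_pow g h

lemma frob_span (f : ℕ) (x : R) (A : Ideal R) :
    adj (iterateFrobenius R p f) (Ideal.span {x ^ p ^ f} * A)
      = Ideal.span {x} * adj (iterateFrobenius R p f) A := by
  have := (hG f).adj_mul x A
  rwa [iterateFrobenius_def] at this

lemma IGe_scale (e f n : ℕ) : IGe p g (e + f) (n * p ^ f) = IGe p g e n := by
  unfold IGe
  rw [add_comm, ← adj_frob p hG]
  congr 1
  have := frob_span p hG f (g ^ n) ⊤
  rwa [Ideal.mul_top, (hG f).adj_top, Ideal.mul_top, ← pow_mul] at this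

lemma IGe_add (e n : ℕ) : IGe p g e (n + p ^ e) = Ideal.span {g} * IGe p g e n := by
  unfold IGe
  rw [← frob_span p hG, Ideal.span_singleton_mul_span_singleton, pow_add, mul_comm]

lemma IGe_adj (e f n : ℕ) : adj (iterateFrobenius R p f) (IGe p g e n) = IGe p g (e + f) n :=
  adj_frob p hG _ _ _

lemma IGe_right (hp : p.Prime) (hg : g ≠ 0) : ∃ f, ∀ e n, IGe p g (e + f) (n * p ^ f + 1) = IGe p g e n := by
  obtain ⟨f, hf⟩ : ∃ f : ℕ, g ∉ (IsLocalRing.maximalIdeal R).map (iterateFrobenius R p f) := by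
    by_contra hcon
    push Not at hcon
    apply hg
    have := krull_mem (⊥ : Ideal R) g (fun l => by
      rw [bot_sup_eq]
      have h1 : (IsLocalRing.maximalIdeal R).map (iterateFrobenius R p l)
          ≤ (IsLocalRing.maximalIdeal R) ^ (p ^ l) := by
        rw [Ideal.map_le_iff_le_comap]
        intro x hx
        rw [Ideal.mem_comap, iterateFrobenius_def]
        exact Ideal.pow_mem_pow hx _
      exact Ideal.pow_le_pow_right (Nat.lt_pow_self hp.one_lt).le (h1 (hcon l)))
    simpa using this
  have htop : adj (iterateFrobenius R p f) (Ideal.span {g}) = ⊤ := by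
    by_contra h
    have h1 := IsLocalRing.le_maximalIdeal h
    rw [(hG f).adj_le, Ideal.span_singleton_le_iff_mem] at h1
    exact hf h1
  refine ⟨f, fun e n => ?_⟩
  unfold IGe
  rw [add_comm, ← adj_frob p hG]
  congr 1
  have := frob_span p hG f (g ^ n) (Ideal.span {g})
  rwa [htop, Ideal.mul_top, Ideal.span_singleton_mul_span_singleton, ← pow_mul, ← pow_succ] at this

lemma IGe_stab (hp : p.Prime) (k m : ℕ) (hk : 1 ≤ k) :
    ∃ s, ∀ t, s ≤ t → IGe p g (k * t) (m * ∑ i ∈ Finset.range t, (p ^ k) ^ i)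
      = IGe p g (k * s) (m * ∑ i ∈ Finset.range s, (p ^ k) ^ i) := by
  apply (hG k).stab (p ^ k) ?_ (fun x => rfl) (g ^ m)
    (fun s => IGe p g (k * s) (m * ∑ i ∈ Finset.range s, (p ^ k) ^ i))
  · simp only [Finset.range_zero, Finset.sum_empty, mul_zero]
    unfold IGe
    rw [pow_zero, Ideal.span_singleton_one, (hG 0).adj_top]
  · intro s
    rw [Finset.sum_range_succ, mul_add, mul_add, mul_one, ← IGe_adj p hG]
    congr 1
    unfold IGe
    rw [← frob_span p hG, Ideal.span_singleton_mul_span_singleton]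
    congr 3
    rw [← pow_mul, ← pow_mul, ← pow_add, add_comm]
  · calc 2 ≤ p := hp.two_le
      _ = p ^ 1 := (pow_one p).symm
      _ ≤ p ^ k := Nat.pow_le_pow_right hp.pos hk

lemma tau_eq (c : ℝ) : tau p (Ideal.span {g}) c
    = ⨆ e : {e : ℕ // 1 ≤ e}, IGe p g e ⌈c * (p : ℝ) ^ (e : ℕ)⌉₊ := by
  unfold tau
  congr 1
  funext e
  rw [Ideal.span_singleton_pow]
  rfl

lemma IGe_ceil_mono (c : ℝ) : Monotone fun e : ℕ => IGe p g e ⌈c * (p : ℝ) ^ e⌉₊ := by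
  apply monotone_nat_of_le_succ
  intro e
  rw [← IGe_scale p hG g e 1]
  apply IGe_anti p hG
  rw [Nat.ceil_le, pow_succ, ← mul_assoc]
  push_cast
  rw [pow_one]
  gcongr
  exact Nat.le_ceil _

lemma tau_stab (c : ℝ) : ∃ e₀, ∀ e, e₀ ≤ e →
    tau p (Ideal.span {g}) c = IGe p g e ⌈c * (p : ℝ) ^ e⌉₊ := by
  obtain ⟨n, hn⟩ := monotone_stabilizes_iff_noetherian.mpr ‹IsNoetherianRing R›
    ⟨_, IGe_ceil_mono p hG g c⟩
  have hn' : ∀ e, n ≤ e → IGe p g n ⌈c * (p : ℝ) ^ n⌉₊ = IGe p g e ⌈c * (p : ℝ) ^ e⌉₊ := hn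
  refine ⟨n + 1, fun e he => ?_⟩
  rw [tau_eq p hG]
  apply le_antisymm
  · refine iSup_le fun i => ?_
    rw [← hn' e (by omega), hn' (max n i) (le_max_left _ _)]
    exact IGe_ceil_mono p hG g c (le_max_right n (i : ℕ))
  · exact le_iSup (fun e : {e : ℕ // 1 ≤ e} => IGe p g e ⌈c * (p : ℝ) ^ (e : ℕ)⌉₊) ⟨e, by omega⟩

lemma tau_anti {c d : ℝ} (h : c ≤ d) : tau p (Ideal.span {g}) d ≤ tau p (Ideal.span {g}) c := by
  rw [tau_eq p hG, tau_eq p hG]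
  refine iSup_mono fun e => IGe_anti p hG g _ (Nat.ceil_mono ?_)
  gcongr

lemma tau_frac (hp : p.Prime) (n e : ℕ) :
    tau p (Ideal.span {g}) ((n : ℝ) / (p : ℝ) ^ e) = IGe p g e n := by
  obtain ⟨e₀, h⟩ := tau_stab p hG g ((n : ℝ) / (p : ℝ) ^ e)
  rw [h (e + e₀) (by omega), ← IGe_scale p hG g e e₀ n]
  congr 1
  have hp0 : (p : ℝ) ≠ 0 := by exact_mod_cast hp.ne_zero
  have : (n : ℝ) / (p : ℝ) ^ e * (p : ℝ) ^ (e + e₀) = ((n * p ^ e₀ : ℕ) : ℝ) := by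
    push_cast
    rw [pow_add]
    field_simp
  rw [this, Nat.ceil_natCast]

lemma tau_mul (c : ℝ) : tau p (Ideal.span {g}) c
    = adj (iterateFrobenius R p 1) (tau p (Ideal.span {g}) (p * c)) := by
  obtain ⟨e₀, h⟩ := tau_stab p hG g c
  obtain ⟨e₁, h'⟩ := tau_stab p hG g (p * c)
  rw [h (max e₀ e₁ + 1) (by omega), h' (max e₀ e₁) (by omega), IGe_adj p hG]
  congr 2
  ring

lemma tau_add_one (c : ℝ) (hc : 0 ≤ c) : tau p (Ideal.span {g}) (c + 1)
    = Ideal.span {g} * tau p (Ideal.span {g}) c := by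
  obtain ⟨e₀, h⟩ := tau_stab p hG g c
  obtain ⟨e₁, h'⟩ := tau_stab p hG g (c + 1)
  rw [h (max e₀ e₁) (by omega), h' (max e₀ e₁) (by omega), ← IGe_add p hG]
  congr 1
  have : (c + 1) * (p : ℝ) ^ (max e₀ e₁) = c * (p : ℝ) ^ (max e₀ e₁) + ((p ^ (max e₀ e₁) : ℕ) : ℝ) := by
    push_cast; ring
  rw [this, Nat.ceil_add_natCast (by positivity)]

lemma not_jump {a b y : ℝ} (ha : 0 ≤ a) (hay : a < y) (hyb : y ≤ b)
    (h : tau p (Ideal.span {g}) a = tau p (Ideal.span {g}) b) :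
    ¬ IsFJumpingCoeff p (Ideal.span {g}) y := by
  intro hy
  apply hy.2 ((y - a) / 2) (by linarith) (by linarith)
  apply le_antisymm
  · exact tau_anti p hG g (by linarith)
  · refine (tau_anti p hG g (show a ≤ y - (y - a) / 2 by linarith)).trans ?_
    rw [h]
    exact tau_anti p hG g hyb

theorem main_aux (hp : p.Prime) :
    (∀ c : ℝ, IsFJumpingCoeff p (Ideal.span {g}) c → ∃ q : ℚ, c = (q : ℝ)) ∧
    (∀ x : ℝ, ¬ IsAccumulationPt {c : ℝ | IsFJumpingCoeff p (Ideal.span {g}) c} x) := by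
  have hp0 : (0 : ℝ) < p := by exact_mod_cast hp.pos
  have hp1 : (1 : ℝ) < p := by exact_mod_cast hp.one_lt
  refine real_part hp.two_le (fun c hc => hc.1) ?_ ?_ ?_ ?_
  · rintro c ⟨hc, hj⟩
    refine ⟨by positivity, fun ε h1 h2 heq => ?_⟩
    refine hj (ε / p) (by positivity) (by rw [div_lt_iff₀ hp0]; linarith) ?_
    rw [tau_mul p hG g c, tau_mul p hG g (c - ε / p), heq]
    congr 2
    field_simp
  · rintro c ⟨hc, hj⟩ hc1
    refine ⟨by linarith, fun ε h1 h2 heq => ?_⟩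
    refine hj ε h1 (by linarith) ?_
    have e1 := tau_add_one p hG g (c - 1) (by linarith)
    have e2 := tau_add_one p hG g (c - 1 - ε) (by linarith)
    rw [heq, ← e2] at e1
    convert e1 using 2 <;> ring
  · intro x hx
    by_cases hg : g = 0
    · refine ⟨1, one_pos, fun y hy _ => ?_⟩
      have hz : ∀ c : ℝ, 0 < c → tau p (Ideal.span {g}) c = ⊥ := by
        intro c hc
        rw [tau_eq p hG, eq_bot_iff]
        refine iSup_le fun e => ?_
        unfold IGe
        rw [(hG _).adj_le, hg, zero_pow, Ideal.map_bot]
        · simp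
        · have : 0 < ⌈c * (p : ℝ) ^ (e : ℕ)⌉₊ := Nat.ceil_pos.mpr (by positivity)
          omega
      have hy' : IsFJumpingCoeff p (Ideal.span {g}) y := hy
      have hy0 := hy'.1
      exact hy'.2 (y / 2) (by linarith) (by linarith) (by rw [hz _ hy0, hz _ (by linarith)])
    · obtain ⟨f, hf⟩ := IGe_right p hG g hp hg
      obtain ⟨e, he⟩ := tau_stab p hG g x
      have he' := he e le_rfl
      set n := ⌈x * (p : ℝ) ^ e⌉₊ with hn
      have h1 : x * (p : ℝ) ^ e ≤ n := Nat.le_ceil _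
      set b : ℝ := ((n * p ^ f + 1 : ℕ) : ℝ) / (p : ℝ) ^ (e + f) with hb
      have h2 : tau p (Ideal.span {g}) x = tau p (Ideal.span {g}) b := by
        rw [he', hb, tau_frac p hG g hp, hf]
      have h3 : x < b := by
        rw [hb, lt_div_iff₀ (by positivity), pow_add, ← mul_assoc]
        push_cast
        have := mul_le_mul_of_nonneg_right h1 (show (0:ℝ) ≤ (p : ℝ) ^ f by positivity)
        linarith
      refine ⟨b - x, by linarith, fun y hy hxy => ?_⟩
      exact not_jump p hG g hx hxy.1 (by linarith [hxy.2]) h2 hy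
  · intro k m hk hm
    obtain ⟨s, hs⟩ := IGe_stab p hG g hp k m hk
    have hq : (1 : ℝ) < (p : ℝ) ^ k := one_lt_pow₀ hp1 (by omega)
    set q : ℝ := (p : ℝ) ^ k with hqd
    let N : ℕ → ℕ := fun t => m * ∑ i ∈ Finset.range t, (p ^ k) ^ i
    let c : ℕ → ℝ := fun t => (N t : ℝ) / (p : ℝ) ^ (k * t)
    have hτ : ∀ t, s ≤ t → tau p (Ideal.span {g}) (c s) = tau p (Ideal.span {g}) (c t) := by
      intro t ht
      simp only [c]
      rw [tau_frac p hG g hp, tau_frac p hG g hp]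
      exact (hs t ht).symm
    have hc : ∀ t, c t = (m : ℝ) / (q - 1) - (m : ℝ) / (q - 1) * (q⁻¹) ^ t := by
      intro t
      simp only [c, N]
      push_cast
      rw [geom_sum_eq (by rw [← hqd]; linarith), pow_mul, ← hqd]
      have : q - 1 ≠ 0 := by linarith
      have : q ≠ 0 := by linarith
      field_simp
      rw [mul_sub, ← mul_pow]
      field_simp
      simp
    have hx : 0 < (m : ℝ) / (q - 1) := div_pos (by exact_mod_cast hm) (by linarith)
    have hqi : (0:ℝ) < q⁻¹ := by positivity
    have hpos : ∀ t, 0 < (m : ℝ) / (q - 1) * (q⁻¹) ^ t := fun t => by positivity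
    refine ⟨(m : ℝ) / (q - 1) * (q⁻¹) ^ s, hpos s, fun y hy hxy => ?_⟩
    rw [← hc s] at hxy
    obtain ⟨t, ht⟩ := exists_pow_lt_of_lt_one
      (show 0 < ((m : ℝ) / (q - 1) - y) / ((m : ℝ) / (q - 1)) from
        div_pos (by linarith [hxy.2]) hx) (inv_lt_one_of_one_lt₀ hq)
    rw [lt_div_iff₀ hx] at ht
    have ht' : (q⁻¹) ^ (s + t) ≤ (q⁻¹) ^ t :=
      pow_le_pow_of_le_one hqi.le (inv_lt_one_of_one_lt₀ hq).le (by omega)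
    have hyb : y ≤ c (s + t) := by
      rw [hc]
      have := mul_le_mul_of_nonneg_left ht' hx.le
      linarith
    exact not_jump p hG g (by simp only [c]; positivity) hxy.1 hyb (hτ (s+t) (by omega)) hy
end


/-- Every F-jumping coefficient of a principal ideal of a complete regular local ring of
characteristic `p > 0` is rational, and the set of F-jumping coefficients is discrete in `ℝ`. -/
theorem stmt0 {R : Type*} [CommRing R] [IsNoetherianRing R] [IsLocalRing R]
    [IsAdicComplete (IsLocalRing.maximalIdeal R) R]
    (p : ℕ) (hp : p.Prime) [CharP R p]
    (hreg : IsRegularStmt R) (g : R) :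
    (∀ c : ℝ, IsFJumpingCoeff p (Ideal.span {g}) c → ∃ q : ℚ, c = (q : ℝ)) ∧
    (∀ x : ℝ, ¬ IsAccumulationPt {c : ℝ | IsFJumpingCoeff p (Ideal.span {g}) c} x) := by
  have hexp : ExpChar R p := ExpChar.prime hp
  exact main_aux p (goodHom_frob p hp hreg) g hp
end

section
/- Let R be a Noetherian regular local ring of prime characteristic p > 0 satisfying condition (*), and let a be an ideal of R. If the set of F-jumping coefficients of a has no rational accumulation points, then the set of F-jumping coefficients of a has no accumulation points in ℝ at all (it is a discrete subset of ℝ) and every F-jumping coefficient of a is rational. -/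
open IsLocalRing in

theorem aux_exchange {R : Type*} [CommRing R] [IsLocalRing R] [DecidableEq R] (s : Finset R)
    (hs : maximalIdeal R = Ideal.span (s : Set R)) (x : R) (hx : x ∈ maximalIdeal R)
    (hx2 : x ∉ maximalIdeal R ^ 2) :
    ∃ i ∈ s, i ∈ Ideal.span (insert x ((s.erase i : Finset R) : Set R)) := by
  have hx' := hx
  rw [hs, Ideal.span, Submodule.mem_span_finset] at hx'
  obtain ⟨f, -, hf⟩ := hx'
  by_contra! hcon
  apply hx2
  rw [← hf]
  refine Ideal.sum_mem _ fun i hi => ?_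
  have him : i ∈ maximalIdeal R := by rw [hs]; exact Ideal.subset_span hi
  have hfi : f i ∈ maximalIdeal R := by
    by_contra hu
    have hu : IsUnit (f i) := by simpa using hu
    apply hcon i hi
    obtain ⟨v, hv⟩ := hu.exists_right_inv
    have h1 : f i * i = x - ∑ j ∈ s.erase i, f j * j := by
      rw [← hf, ← Finset.add_sum_erase s _ hi]; simp
    have h2 : i = v * (x - ∑ j ∈ s.erase i, f j * j) := by
      rw [← h1]; linear_combination (-i) * hv
    have h3 : v * (x - ∑ j ∈ s.erase i, f j * j) ∈
        Ideal.span (insert x ((s.erase i : Finset R) : Set R)) := by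
      refine Ideal.mul_mem_left _ _ (Ideal.sub_mem _ (Ideal.subset_span (by simp)) ?_)
      refine Ideal.sum_mem _ fun j hj => Ideal.mul_mem_left _ _ (Ideal.subset_span ?_)
      exact Set.mem_insert_of_mem _ hj
    rwa [← h2] at h3
  rw [pow_two, smul_eq_mul]
  exact Ideal.mul_mem_mul hfi him

open IsLocalRing in
theorem aux_domain (d : ℕ) : ∀ (R : Type*) [CommRing R] [IsLocalRing R] [IsNoetherianRing R]
    (s : Finset R), maximalIdeal R = Ideal.span (s : Set R) → s.card ≤ d →
    (d : WithBot ℕ∞) ≤ ringKrullDim R → IsDomain R := by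
  classical
  induction d with
  | zero =>
    intro R _ _ _ s hs hc _
    have : s = ∅ := by simpa using hc
    subst this
    have hb : maximalIdeal R = ⊥ := by simpa using hs
    exact (IsLocalRing.isField_iff_maximalIdeal_eq.mpr hb).isDomain
  | succ d ih =>
    intro R _ _ _ s hs hc hd
    have hmin : ¬ (maximalIdeal R ∈ minimalPrimes R) := by
      intro h
      have h0 : (maximalIdeal R).height = 0 := by
        rw [Ideal.height_eq_zero_iff]; exact h
      rw [← maximalIdeal_height_eq_ringKrullDim, h0] at hd
      have : ((d + 1 : ℕ) : WithBot ℕ∞) ≤ ((0 : ℕ) : WithBot ℕ∞) := by simp at hd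
      have := Nat.cast_le.mp this
      omega
    have hsq : ¬ (maximalIdeal R ≤ maximalIdeal R ^ 2) := by
      intro h
      have hb : maximalIdeal R = ⊥ := by
        refine Submodule.eq_bot_of_le_smul_of_le_jacobson_bot (maximalIdeal R) (maximalIdeal R)
          (IsNoetherian.noetherian _) ?_ ?_
        · rw [smul_eq_mul, ← pow_two]; exact h
        · exact (IsLocalRing.jacobson_eq_maximalIdeal ⊥ bot_ne_top).ge
      apply hmin
      have := (IsLocalRing.isField_iff_maximalIdeal_eq.mpr hb).isDomain
      rw [hb, IsDomain.minimalPrimes_eq_singleton_bot]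
      rfl
    obtain ⟨x, hxm, hx2, hxmin⟩ : ∃ x ∈ maximalIdeal R, x ∉ maximalIdeal R ^ 2 ∧
        ∀ Q ∈ minimalPrimes R, x ∉ Q := by
      by_contra! hcon
      have fin : (insert (maximalIdeal R ^ 2) (minimalPrimes R)).Finite :=
        (minimalPrimes.finite_of_isNoetherianRing R).insert _
      have := (Ideal.subset_union_prime_finite fin (f := id) (maximalIdeal R ^ 2)
        (maximalIdeal R ^ 2) (I := maximalIdeal R) (by
          intro i hi hne _
          rcases hi with h | h
          · exact absurd h hne
          · exact h.1.1)).1 (by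
          intro x hx
          by_cases h2 : x ∈ maximalIdeal R ^ 2
          · exact Set.mem_biUnion (Set.mem_insert _ _) h2
          · obtain ⟨Q, hQ, hxQ⟩ := hcon x hx h2
            exact Set.mem_biUnion (Set.mem_insert_of_mem _ hQ) hxQ)
      obtain ⟨Q, hQ, hle⟩ := this
      rcases hQ with h | h
      · subst h; exact hsq hle
      · have hp : Q.IsPrime := h.1.1
        have : Q = maximalIdeal R := le_antisymm (le_maximalIdeal hp.ne_top) hle
        exact hmin (this ▸ h)
    obtain ⟨i, his, hi⟩ := aux_exchange s hs x hxm hx2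
    have hne : Ideal.span {x} ≠ ⊤ := by
      intro h
      have : Ideal.span {x} ≤ maximalIdeal R := by simpa [Ideal.span_le] using hxm
      rw [h] at this
      exact (maximalIdeal.isMaximal R).ne_top (top_le_iff.mp this)
    have : Nontrivial (R ⧸ Ideal.span {x}) := Ideal.Quotient.nontrivial_iff.mpr hne
    have : IsLocalRing (R ⧸ Ideal.span {x}) :=
      IsLocalRing.of_surjective' (Ideal.Quotient.mk _) Ideal.Quotient.mk_surjective
    have hdom : IsDomain (R ⧸ Ideal.span {x}) := by
      refine ih (R ⧸ Ideal.span {x}) ((s.erase i).image (Ideal.Quotient.mk _)) ?_ ?_ ?_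
      · have hmax : maximalIdeal (R ⧸ Ideal.span {x}) =
            (maximalIdeal R).map (Ideal.Quotient.mk _) := by
          have h1 : ((maximalIdeal R).map (Ideal.Quotient.mk (Ideal.span {x}))).IsMaximal := by
            refine Ideal.IsMaximal.map_of_surjective_of_ker_le Ideal.Quotient.mk_surjective ?_
            rw [Ideal.mk_ker]; simpa [Ideal.span_le] using hxm
          exact (IsLocalRing.eq_maximalIdeal h1).symm
        rw [hmax, hs, Ideal.map_span, Finset.coe_image]
        apply le_antisymm
        · have : Ideal.span (s : Set R) ≤
              (Ideal.span ((Ideal.Quotient.mk (Ideal.span {x})) '' ((s.erase i : Finset R) : Set R))).comap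
                (Ideal.Quotient.mk (Ideal.span {x})) := by
            have h2 : Ideal.span (insert x ((s.erase i : Finset R) : Set R)) ≤
              (Ideal.span ((Ideal.Quotient.mk (Ideal.span {x})) '' ((s.erase i : Finset R) : Set R))).comap
                (Ideal.Quotient.mk (Ideal.span {x})) := by
              rw [Ideal.span_le]
              intro y hy
              rcases hy with rfl | hy
              · have : (Ideal.Quotient.mk (Ideal.span {y})) y = 0 :=
                  Ideal.Quotient.eq_zero_iff_mem.mpr (Ideal.mem_span_singleton_self _)
                simp [this]
              · exact Ideal.subset_span ⟨y, hy, rfl⟩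
            rw [Ideal.span_le]
            intro y hy
            by_cases hyi : y = i
            · subst hyi; exact h2 hi
            · exact h2 (Ideal.subset_span (Set.mem_insert_of_mem _ (by simp [hyi]; exact hy)))
          rw [← Ideal.map_span, Ideal.map_le_iff_le_comap]
          exact this
        · exact Ideal.span_mono (Set.image_mono (by simp))
      · refine Finset.card_image_le.trans ?_
        rw [Finset.card_erase_of_mem his]; omega
      · have h := ringKrullDim_le_ringKrullDim_quotient_add_card ({x} : Finset R) (by
          rw [Finset.coe_singleton, Set.singleton_subset_iff]
          rw [IsLocalRing.ringJacobson_eq_maximalIdeal]; exact hxm)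
        rw [Finset.coe_singleton, Finset.card_singleton] at h
        have h2 := hd.trans h
        push_cast at h2
        exact (ENat.WithBot.add_le_add_one_right_iff).mp h2
    have hprime : (Ideal.span {x}).IsPrime := (Ideal.Quotient.isDomain_iff_prime _).mp hdom
    obtain ⟨Q, hQ, hQx⟩ := Ideal.exists_minimalPrimes_le (bot_le : ⊥ ≤ Ideal.span {x})
    have hQp : Q.IsPrime := hQ.1.1
    have hQb : Q = ⊥ := by
      refine Submodule.eq_bot_of_le_smul_of_le_jacobson_bot (maximalIdeal R) Q
          (IsNoetherian.noetherian _) ?_ ?_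
      · intro y hy
        obtain ⟨r, rfl⟩ := Ideal.mem_span_singleton'.mp (hQx hy)
        have hr : r ∈ Q := (hQp.mem_or_mem hy).resolve_right (hxmin Q hQ)
        rw [smul_eq_mul, mul_comm r x]
        exact Ideal.mul_mem_mul hxm hr
      · exact (IsLocalRing.jacobson_eq_maximalIdeal ⊥ bot_ne_top).ge
    subst hQb
    have : NoZeroDivisors R := ⟨fun {x y} h => by
      simpa using hQp.mem_or_mem (show x * y ∈ (⊥ : Ideal R) by simp [h])⟩
    exact NoZeroDivisors.to_isDomain R

theorem bp_eq {R : Type*} [CommRing R] (p : ℕ) [ExpChar R p] (J : Ideal R) (e : ℕ) :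
    bracketPow J (p ^ e) = J.map (iterateFrobenius R p e) := rfl

theorem bp_mono {R : Type*} [CommRing R] (q : ℕ) {I J : Ideal R} (h : I ≤ J) :
    bracketPow I q ≤ bracketPow J q := Ideal.span_mono (Set.image_mono h)

theorem Ie_le_iff {R : Type*} [CommRing R] {p : ℕ} (hstar : CondStar R p) {e : ℕ} (he : 1 ≤ e)
    (b J : Ideal R) : Ie p b e ≤ J ↔ b ≤ bracketPow J (p ^ e) :=
  ⟨fun h => (hstar b e he).trans (bp_mono _ h), fun h => sInf_le h⟩

theorem Ie_gc {R : Type*} [CommRing R] {p : ℕ} (hstar : CondStar R p) {e : ℕ} (he : 1 ≤ e) :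
    GaloisConnection (fun b : Ideal R => Ie p b e) (fun J => bracketPow J (p ^ e)) :=
  fun b J => Ie_le_iff hstar he b J

theorem Ie_mono {R : Type*} [CommRing R] (p e : ℕ) {b c : Ideal R} (h : b ≤ c) :
    Ie p b e ≤ Ie p c e := sInf_le_sInf fun _ hI => h.trans hI

theorem Ie_Ie {R : Type*} [CommRing R] {p : ℕ} [ExpChar R p] (hstar : CondStar R p) {e : ℕ}
    (he : 1 ≤ e) (b : Ideal R) : Ie p (Ie p b e) 1 = Ie p b (e + 1) := by
  refine eq_of_forall_ge_iff fun J => ?_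
  rw [Ie_le_iff hstar le_rfl, Ie_le_iff hstar he, Ie_le_iff hstar (by omega), bp_eq, bp_eq, bp_eq,
    Ideal.map_map, iterateFrobenius_add]

/-- Colon property. -/
theorem Ie_colon {R : Type*} [CommRing R] [IsDomain R] {p : ℕ} [ExpChar R p]
    (hstar : CondStar R p) {e : ℕ} (he : 1 ≤ e) (b J : Ideal R) (u : R)
    (h : ∀ y ∈ b, u ^ p ^ e * y ∈ bracketPow J (p ^ e)) : ∀ z ∈ Ie p b e, u * z ∈ J := by
  by_cases hu : u = 0
  · intro z _; simp [hu]
  let K : Ideal R := Submodule.comap (LinearMap.mulLeft R u) J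
  suffices Ie p b e ≤ K from fun z hz => this hz
  rw [Ie_le_iff hstar he]
  intro y hy
  have h1 : u ^ p ^ e * y ∈ bracketPow (J ⊓ Ideal.span {u}) (p ^ e) := by
    have := (Ie_gc hstar he).u_inf (b₁ := J) (b₂ := Ideal.span {u})
    rw [this]
    refine ⟨h y hy, Ideal.mul_mem_right _ _ (Ideal.subset_span ⟨u, ?_, rfl⟩)⟩
    exact Ideal.mem_span_singleton_self u
  have h2 : J ⊓ Ideal.span {u} ≤ Ideal.span {u} * K := by
    rintro w ⟨hw, hwu⟩
    obtain ⟨r, rfl⟩ := Ideal.mem_span_singleton'.mp hwu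
    rw [mul_comm r u] at hw ⊢
    exact Ideal.mul_mem_mul (Ideal.mem_span_singleton_self u) hw
  have h3 := bp_mono (p ^ e) h2 h1
  rw [bp_eq, Ideal.map_mul, Ideal.map_span, Set.image_singleton, ← bp_eq,
    Ideal.mem_span_singleton_mul] at h3
  obtain ⟨z, hz, hzy⟩ := h3
  rw [iterateFrobenius_def] at hzy
  rwa [← mul_left_cancel₀ (pow_ne_zero _ hu) hzy]

theorem Ie_mul {R : Type*} [CommRing R] [IsDomain R] {p : ℕ} [ExpChar R p]
    (hstar : CondStar R p) {e : ℕ} (he : 1 ≤ e) (a b : Ideal R) :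
    Ie p (bracketPow a (p ^ e) * b) e = a * Ie p b e := by
  apply le_antisymm
  · rw [Ie_le_iff hstar he]
    conv_rhs => rw [bp_eq, Ideal.map_mul, ← bp_eq, ← bp_eq]
    exact Ideal.mul_mono_right (hstar b e he)
  · rw [Ideal.mul_le]
    intro u hu
    refine Ie_colon hstar he _ _ u fun y hy => ?_
    exact hstar _ e he (Ideal.mul_mem_mul (Ideal.subset_span ⟨u, hu, rfl⟩) hy)

theorem skoda_pow {R : Type*} [CommRing R] (a : Ideal R) (ha : a.FG) :
    ∃ m : ℕ, 1 ≤ m ∧ ∀ q r : ℕ, m * q ≤ r → a ^ r ≤ bracketPow a q * a ^ (r - q) := by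
  classical
  obtain ⟨s, rfl⟩ := ha
  induction s using Finset.induction_on with
  | empty =>
    refine ⟨1, le_rfl, fun q r hqr => ?_⟩
    rcases Nat.eq_zero_or_pos q with rfl | hq
    · have : bracketPow (Ideal.span ((∅ : Finset R) : Set R)) 0 = ⊤ := by
        rw [Ideal.eq_top_iff_one]
        exact Ideal.subset_span ⟨0, by simp, by simp⟩
      rw [this]; simp
    · have : r ≠ 0 := by omega
      have h0 : (Ideal.span ((∅ : Finset R) : Set R)) ^ r = 0 := by
        rw [Finset.coe_empty, Ideal.span_empty, ← Ideal.zero_eq_bot, zero_pow this]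
      rw [h0]; exact bot_le
  | insert u s _ ih =>
    obtain ⟨m, hm0, hm⟩ := ih
    refine ⟨m + 1, by omega, fun q r hr => ?_⟩
    rw [Finset.coe_insert, Ideal.span_insert]
    set b := Ideal.span (s : Set R)
    set U := Ideal.span {u}
    have hU : U ≤ U ⊔ b := le_sup_left
    have hb : b ≤ U ⊔ b := le_sup_right
    have hexp : (U ⊔ b) ^ r = (U + b) ^ r := rfl
    conv_lhs => rw [hexp, add_pow]
    rw [Ideal.sum_eq_sup]
    refine Finset.sup_le fun i hi => ?_
    have hir : i ≤ r := by simpa [Nat.lt_succ_iff] using hi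
    refine Ideal.mul_le_left.trans ?_
    by_cases hiq : q ≤ i
    · have h1 : U ^ i * b ^ (r - i) = U ^ q * (U ^ (i - q) * b ^ (r - i)) := by
        rw [← mul_assoc, ← pow_add]; congr 2; omega
      rw [h1]
      refine Ideal.mul_mono ?_ ?_
      · rw [Ideal.span_singleton_pow, Ideal.span_singleton_le_iff_mem]
        exact Ideal.subset_span ⟨u, hU (Ideal.mem_span_singleton_self u), rfl⟩
      · have h2 : r - q = (i - q) + (r - i) := by omega
        rw [h2, pow_add]
        exact Ideal.mul_mono (Ideal.pow_right_mono hU _) (Ideal.pow_right_mono hb _)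
    · have hri : m * q ≤ r - i := by
        have : (m + 1) * q = m * q + q := by ring
        omega
      have hqi : q ≤ r - i := le_trans (Nat.le_mul_of_pos_left q hm0) hri
      have h1 := hm q (r - i) hri
      refine (Ideal.mul_mono_right h1).trans ?_
      rw [mul_left_comm]
      refine Ideal.mul_mono (bp_mono _ hb) ?_
      have h2 : r - q = i + (r - i - q) := by omega
      rw [h2, pow_add]
      exact Ideal.mul_mono (Ideal.pow_right_mono hU _) (Ideal.pow_right_mono hb _)

theorem tau_anti_s1 {R : Type*} [CommRing R] (p : ℕ) (a : Ideal R) {c c' : ℝ} (h : c ≤ c') :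
    tau p a c' ≤ tau p a c := by
  refine iSup_mono fun e => Ie_mono _ _ (Ideal.pow_le_pow_right (Nat.ceil_mono ?_))
  exact mul_le_mul_of_nonneg_right h (by positivity)

theorem tau_rec {R : Type*} [CommRing R] {p : ℕ} [ExpChar R p] (hstar : CondStar R p)
    (a : Ideal R) (c : ℝ) :
    tau p a c = Ie p (a ^ ⌈c * (p : ℝ)⌉₊) 1 ⊔ Ie p (tau p a (p * c)) 1 := by
  have h1 : Ie p (tau p a (p * c)) 1 =
      ⨆ e : {e : ℕ // 1 ≤ e}, Ie p (a ^ ⌈c * (p : ℝ) ^ ((e : ℕ) + 1)⌉₊) ((e : ℕ) + 1) := by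
    unfold tau
    rw [(Ie_gc hstar le_rfl).l_iSup]
    refine iSup_congr fun e => ?_
    rw [Ie_Ie hstar e.2]
    congr 3
    ring
  rw [h1]
  apply le_antisymm
  · refine iSup_le fun ⟨e, he⟩ => ?_
    rcases Nat.lt_or_ge e 2 with h | h
    · obtain rfl : e = 1 := by omega
      refine le_trans (le_of_eq ?_) le_sup_left
      simp
    · refine le_trans ?_ le_sup_right
      obtain ⟨k, rfl⟩ : ∃ k, e = k + 1 := ⟨e - 1, by omega⟩
      exact le_iSup (fun e : {e : ℕ // 1 ≤ e} =>
        Ie p (a ^ ⌈c * (p : ℝ) ^ ((e : ℕ) + 1)⌉₊) ((e : ℕ) + 1)) ⟨k, by omega⟩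
  · refine sup_le ?_ (iSup_le fun ⟨e, he⟩ => ?_)
    · refine le_trans (le_of_eq ?_) (le_iSup (fun e : {e : ℕ // 1 ≤ e} =>
        Ie p (a ^ ⌈c * (p : ℝ) ^ (e : ℕ)⌉₊) (e : ℕ)) ⟨1, le_rfl⟩)
      simp
    · exact le_iSup (fun e : {e : ℕ // 1 ≤ e} =>
        Ie p (a ^ ⌈c * (p : ℝ) ^ (e : ℕ)⌉₊) (e : ℕ)) ⟨e + 1, by omega⟩

theorem tau_skoda {R : Type*} [CommRing R] [IsDomain R] [IsNoetherianRing R] {p : ℕ}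
    [ExpChar R p] (hstar : CondStar R p) (a : Ideal R) :
    ∃ m : ℕ, 1 ≤ m ∧ ∀ c : ℝ, m ≤ c → tau p a c = a * tau p a (c - 1) := by
  obtain ⟨m, hm1, hm⟩ := skoda_pow a (IsNoetherian.noetherian a)
  refine ⟨m, hm1, fun c hc => ?_⟩
  unfold tau
  rw [Ideal.mul_iSup]
  refine iSup_congr fun ⟨e, he⟩ => ?_
  simp only
  rw [← Ie_mul hstar he]
  congr 1
  have hq : ⌈(c - 1) * (p : ℝ) ^ e⌉₊ = ⌈c * (p : ℝ) ^ e⌉₊ - p ^ e := by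
    rw [← Nat.ceil_sub_natCast]; congr 1; push_cast; ring
  have hr : m * p ^ e ≤ ⌈c * (p : ℝ) ^ e⌉₊ := by
    have : ((m * p ^ e : ℕ) : ℝ) ≤ c * (p : ℝ) ^ e := by
      push_cast
      exact mul_le_mul_of_nonneg_right hc (by positivity)
    exact_mod_cast this.trans (Nat.le_ceil _)
  have hr' : p ^ e ≤ ⌈c * (p : ℝ) ^ e⌉₊ := (Nat.le_mul_of_pos_left _ hm1).trans hr
  rw [hq]
  apply le_antisymm
  · exact hm _ _ hr
  · conv_rhs => rw [← Nat.add_sub_cancel' hr', pow_add]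
    refine Ideal.mul_mono_left ?_
    refine Ideal.span_le.mpr ?_
    rintro _ ⟨x, hx, rfl⟩
    exact Ideal.pow_mem_pow hx _

/-- A failure of jumping persists for smaller `ε`. -/
theorem not_jump_s1 {R : Type*} [CommRing R] {p : ℕ} {a : Ideal R} {c : ℝ} (hc : 0 < c)
    (h : ¬ IsFJumpingCoeff p a c) :
    ∃ δ > 0, ∀ ε, 0 < ε → ε ≤ δ → tau p a c = tau p a (c - ε) := by
  unfold IsFJumpingCoeff at h
  push Not at h
  obtain ⟨δ, h0, _, heq⟩ := h hc
  refine ⟨δ, h0, fun ε hε hεδ => le_antisymm (tau_anti_s1 p a (by linarith)) ?_⟩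
  rw [heq]
  exact tau_anti_s1 p a (by linarith)

theorem jump_mul {R : Type*} [CommRing R] {p : ℕ} [ExpChar R p] (hp : 0 < p)
    (hstar : CondStar R p) {a : Ideal R} {c : ℝ} (hc : IsFJumpingCoeff p a c) :
    IsFJumpingCoeff p a (p * c) := by
  by_contra hcon
  have hp' : (0 : ℝ) < p := by exact_mod_cast hp
  obtain ⟨hc0, hc⟩ := hc
  obtain ⟨δ, hδ, h⟩ := not_jump_s1 (by positivity) hcon
  set N := ⌈c * (p : ℝ)⌉₊ with hN
  have hNpos : 0 < N := Nat.ceil_pos.mpr (by positivity)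
  have hlt : (N : ℝ) - 1 < c * p := by
    have := Nat.ceil_lt_add_one (show 0 ≤ c * (p : ℝ) by positivity)
    linarith
  set ε := min (min (δ / p) (c / 2)) ((c * p - (N - 1)) / (2 * p)) with hε
  have hε0 : 0 < ε := by
    refine lt_min (lt_min (by positivity) (by positivity)) (div_pos (by linarith) (by positivity))
  have h1 : ε ≤ δ / p := (min_le_left _ _).trans (min_le_left _ _)
  have h2 : ε ≤ c / 2 := (min_le_left _ _).trans (min_le_right _ _)
  have h3 : ε ≤ (c * p - (N - 1)) / (2 * p) := min_le_right _ _
  rw [le_div_iff₀ hp'] at h1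
  rw [le_div_iff₀ (by positivity)] at h3
  apply hc ε hε0 (by linarith)
  rw [tau_rec hstar a c, tau_rec hstar a (c - ε)]
  congr 1
  · congr 2
    symm
    rw [← hN, Nat.ceil_eq_iff hNpos.ne']
    constructor
    · rw [Nat.cast_sub hNpos]; push_cast; nlinarith
    · have := Nat.le_ceil (c * (p : ℝ))
      rw [← hN] at this
      nlinarith
  · rw [h (p * ε) (by positivity) (by linarith)]
    congr 2
    ring

theorem jump_sub {R : Type*} [CommRing R] {p : ℕ} {a : Ideal R} {m : ℕ} (hm : 1 ≤ m)
    (hsk : ∀ c : ℝ, m ≤ c → tau p a c = a * tau p a (c - 1)) {c : ℝ} (hmc : m < c)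
    (hc : IsFJumpingCoeff p a c) : IsFJumpingCoeff p a (c - 1) := by
  by_contra hcon
  have hm' : (1 : ℝ) ≤ m := by exact_mod_cast hm
  obtain ⟨hc0, hc⟩ := hc
  obtain ⟨δ, hδ, h⟩ := not_jump_s1 (by linarith) hcon
  have h1 : min δ (c - m) ≤ δ := min_le_left _ _
  have h2 : min δ (c - m) ≤ c - m := min_le_right _ _
  have h0 : 0 < min δ (c - m) := lt_min hδ (by linarith)
  apply hc (min δ (c - m)) h0 (by linarith)
  rw [hsk c hmc.le, hsk (c - min δ (c - m)) (by linarith), h _ h0 h1]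
  congr 2
  ring

theorem jump_wf {R : Type*} [CommRing R] [IsNoetherianRing R] {p : ℕ} {a : Ideal R}
    (S : Set ℝ) (hS : S ⊆ {c : ℝ | IsFJumpingCoeff p a c}) (hne : S.Nonempty) :
    ∃ x, IsLeast S x := by
  obtain ⟨_, ⟨x, hx, rfl⟩, hmax⟩ :=
    (wellFounded_gt (α := Ideal R)).has_min (tau p a '' S) (hne.image _)
  refine ⟨x, hx, fun y hy => ?_⟩
  by_contra! hlt
  have h1 : tau p a x = tau p a y := by
    by_contra hne
    exact hmax _ ⟨y, hy, rfl⟩ (lt_of_le_of_ne (tau_anti_s1 p a hlt.le) hne)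
  refine (hS hx).2 (x - y) (by linarith) (by linarith [(hS hy).1]) ?_
  rw [h1]; congr 1; ring

theorem jump_closed {R : Type*} [CommRing R] {p : ℕ} {a : Ideal R} (x : ℝ)
    (h : ∀ δ > 0, ∃ y ∈ {c : ℝ | IsFJumpingCoeff p a c}, x - δ < y ∧ y < x) :
    IsFJumpingCoeff p a x := by
  obtain ⟨y, hy, _, hyx⟩ := h 1 one_pos
  refine ⟨hy.1.trans hyx, fun ε h0 hε heq => ?_⟩
  obtain ⟨z, hz, h1, h2⟩ := h ε h0
  refine hz.2 (z - (x - ε)) (by linarith) (by linarith) ?_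
  rw [sub_sub_cancel]
  refine le_antisymm (tau_anti_s1 p a h1.le) ?_
  rw [← heq]
  exact tau_anti_s1 p a h2.le

theorem isAcc_iff (S : Set ℝ) (x : ℝ) : IsAccumulationPt S x ↔ x ∈ derivedSet S := by
  rw [mem_derivedSet, accPt_iff_nhds]
  constructor
  · intro h U hU
    obtain ⟨ε, hε, hb⟩ := Metric.mem_nhds_iff.mp hU
    obtain ⟨y, hy, hne, hd⟩ := h ε hε
    exact ⟨y, ⟨hb (by rwa [Metric.mem_ball, Real.dist_eq]), hy⟩, hne⟩
  · intro h ε hε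
    obtain ⟨y, ⟨hy, hyS⟩, hne⟩ := h _ (Metric.ball_mem_nhds x hε)
    exact ⟨y, hyS, hne, by rwa [Metric.mem_ball, Real.dist_eq] at hy⟩

/-- Subtracting `1` repeatedly. -/
theorem sub_many (D : Set ℝ) (M : ℕ) (hsub : ∀ x ∈ D, (M : ℝ) < x → x - 1 ∈ D) :
    ∀ (n : ℕ) (x : ℝ), x ∈ D → (M : ℝ) < x → x ≤ M + 1 + n →
      ∃ k : ℕ, x - k ∈ D ∧ (M : ℝ) < x - k ∧ x - k ≤ M + 1 := by
  intro n
  induction n with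
  | zero => intro x hx h1 h2; exact ⟨0, by simpa using hx, by simpa using h1, by simpa using h2⟩
  | succ n ih =>
    intro x hx h1 h2
    by_cases h : x ≤ M + 1
    · exact ⟨0, by simpa using hx, by simpa using h1, by simpa using h⟩
    · push Not at h
      push_cast at h2
      obtain ⟨k, hk, hk1, hk2⟩ := ih (x - 1) (hsub x hx h1) (by linarith) (by linarith)
      refine ⟨k + 1, ?_, ?_, ?_⟩ <;> push_cast <;> rw [show x - ((k : ℝ) + 1) = x - 1 - k by ring]
      exacts [hk, hk1, hk2]

theorem sub_many' (D : Set ℝ) (M : ℕ) (hsub : ∀ x ∈ D, (M : ℝ) < x → x - 1 ∈ D)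
    (x : ℝ) (hx : x ∈ D) (h : (M : ℝ) < x) :
      ∃ k : ℕ, x - k ∈ D ∧ (M : ℝ) < x - k ∧ x - k ≤ M + 1 := by
  obtain ⟨n, hn⟩ := exists_nat_ge (x - (M + 1))
  exact sub_many D M hsub n x hx h (by linarith)

theorem mul_many (D : Set ℝ) (p : ℕ) (hmul : ∀ x ∈ D, (p : ℝ) * x ∈ D) (x : ℝ) (hx : x ∈ D)
    (n : ℕ) : (p : ℝ) ^ n * x ∈ D := by
  induction n with
  | zero => simpa using hx
  | succ n ih => rw [pow_succ', mul_assoc]; exact hmul _ ih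

theorem big (p M : ℕ) (hp : 2 ≤ p) (x : ℝ) (hx : 0 < x) : ∃ n : ℕ, (M : ℝ) < (p : ℝ) ^ n * x := by
  obtain ⟨n, hn⟩ := pow_unbounded_of_one_lt ((M : ℝ) / x)
    (show (1 : ℝ) < p by exact_mod_cast hp)
  exact ⟨n, by rwa [div_lt_iff₀ hx] at hn⟩

theorem rat_of_eq (p : ℕ) (hp : 2 ≤ p) (x : ℝ) (n n' k k' : ℕ) (hn : n < n')
    (h : (p : ℝ) ^ n * x - k = (p : ℝ) ^ n' * x - k') : ∃ q : ℚ, x = q := by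
  have h1 : (p : ℝ) ^ n < (p : ℝ) ^ n' :=
    pow_lt_pow_right₀ (by exact_mod_cast hp) hn
  refine ⟨((k' : ℚ) - k) / ((p : ℚ) ^ n' - (p : ℚ) ^ n), ?_⟩
  push_cast
  rw [eq_div_iff (by linarith)]
  linarith

/-- A nonempty closed invariant well-ordered set contains a rational point. -/
theorem exists_rat (A : Set ℝ) (p M : ℕ) (hp : 2 ≤ p) (hM : 1 ≤ M) (hpos : ∀ x ∈ A, 0 < x)
    (wf : ∀ S ⊆ A, S.Nonempty → ∃ x, IsLeast S x) (hcl : IsClosed A)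
    (hmul : ∀ x ∈ A, (p : ℝ) * x ∈ A) (hsub : ∀ x ∈ A, (M : ℝ) < x → x - 1 ∈ A)
    (hne : A.Nonempty) : ∃ q : ℚ, (q : ℝ) ∈ A := by
  have hp' : (2 : ℝ) ≤ p := by exact_mod_cast hp
  have hM' : (1 : ℝ) ≤ M := by exact_mod_cast hM
  let F : Set (Set ℝ) := {C | C ⊆ A ∧ IsClosed C ∧ C.Nonempty ∧ (∀ x ∈ C, (p : ℝ) * x ∈ C) ∧
    (∀ x ∈ C, (M : ℝ) < x → x - 1 ∈ C)}
  have hmeet : ∀ C ∈ F, (C ∩ Set.Icc (M : ℝ) (M + 1)).Nonempty := by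
    rintro C ⟨hCA, _, ⟨x, hx⟩, hm, hs⟩
    obtain ⟨n, hn⟩ := big p M hp x (hpos x (hCA hx))
    obtain ⟨k, hk, h1, h2⟩ := sub_many' C M hs _ (mul_many C p hm x hx n) hn
    exact ⟨_, hk, h1.le, h2⟩
  obtain ⟨C, hCA, hCmin⟩ := zorn_superset_nonempty F (by
    intro c hcF hchain hcne
    refine ⟨⋂₀ c, ⟨?_, ?_, ?_, ?_, ?_⟩, fun s hs => Set.sInter_subset_of_mem hs⟩
    · obtain ⟨s, hs⟩ := hcne
      exact (Set.sInter_subset_of_mem hs).trans (hcF hs).1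
    · exact isClosed_sInter fun s hs => (hcF hs).2.1
    · have : (⋂₀ ((fun s => s ∩ Set.Icc (M : ℝ) (M + 1)) '' c)).Nonempty := by
        have : Nonempty ((fun s => s ∩ Set.Icc (M : ℝ) (M + 1)) '' c) :=
          (hcne.image _).to_subtype
        refine IsCompact.nonempty_sInter_of_directed_nonempty_isCompact_isClosed ?_ ?_ ?_ ?_
        · rintro _ ⟨s, hs, rfl⟩ _ ⟨t, ht, rfl⟩
          rcases hchain.total hs ht with h | h
          · exact ⟨_, ⟨s, hs, rfl⟩, subset_rfl, Set.inter_subset_inter_left _ h⟩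
          · exact ⟨_, ⟨t, ht, rfl⟩, Set.inter_subset_inter_left _ h, subset_rfl⟩
        · rintro _ ⟨s, hs, rfl⟩; exact hmeet s (hcF hs)
        · rintro _ ⟨s, hs, rfl⟩; exact isCompact_Icc.inter_left (hcF hs).2.1
        · rintro _ ⟨s, hs, rfl⟩; exact (hcF hs).2.1.inter isClosed_Icc
      obtain ⟨x, hx⟩ := this
      exact ⟨x, fun s hs => (hx _ ⟨s, hs, rfl⟩).1⟩
    · exact fun x hx s hs => (hcF hs).2.2.2.1 x (hx s hs)
    · exact fun x hx h s hs => (hcF hs).2.2.2.2 x (hx s hs) h) A ⟨subset_rfl, hcl, hne, hmul, hsub⟩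
  obtain ⟨-, hCcl, hCne, hCmul, hCsub⟩ := hCmin.prop
  obtain ⟨s, hsC, hsmin⟩ := wf C hCA hCne
  -- `s` is isolated in `C`
  obtain ⟨δ, hδ, hiso⟩ : ∃ δ > 0, ∀ y ∈ C, |y - s| < δ → y = s := by
    by_cases hE : (C ∩ Set.Ioi s).Nonempty
    · obtain ⟨z, ⟨hzC, hzs⟩, hz⟩ := wf _ (Set.inter_subset_left.trans hCA) hE
      refine ⟨z - s, sub_pos.mpr hzs, fun y hy hd => ?_⟩
      by_contra hne
      have h1 : s < y := lt_of_le_of_ne (hsmin hy) (Ne.symm hne)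
      have h2 := hz ⟨hy, h1⟩
      rw [abs_lt] at hd
      linarith
    · refine ⟨1, one_pos, fun y hy _ => ?_⟩
      by_contra hne
      exact hE ⟨y, hy, lt_of_le_of_ne (hsmin hy) (Ne.symm hne)⟩
  let O : Set ℝ := {x | x ∈ C ∧ ∃ n k : ℕ, 1 ≤ n ∧ x = (p : ℝ) ^ n * s - k ∧
    (k = 0 ∨ (M : ℝ) < x + 1)}
  have hOne : ((p : ℝ) * s) ∈ O := ⟨hCmul s hsC, 1, 0, le_rfl, by simp, Or.inl rfl⟩
  have hOC : closure O ⊆ C := closure_minimal (fun x hx => hx.1) hCcl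
  have hOmul : ∀ x ∈ O, (p : ℝ) * x ∈ O := by
    rintro x ⟨hxC, n, k, hn, hx, hk⟩
    refine ⟨hCmul x hxC, n + 1, p * k, by omega, by rw [hx]; push_cast; ring, ?_⟩
    rcases hk with rfl | hk
    · left; simp
    · right; nlinarith
  have hOsub : ∀ x ∈ O, (M : ℝ) < x → x - 1 ∈ O := by
    rintro x ⟨hxC, n, k, hn, hx, hk⟩ hMx
    exact ⟨hCsub x hxC hMx, n, k + 1, hn, by rw [hx]; push_cast; ring, Or.inr (by linarith)⟩
  have hOF : closure O ∈ F := by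
    refine ⟨hOC.trans hCA, isClosed_closure, ⟨_, subset_closure hOne⟩, ?_, ?_⟩
    · intro x hx
      exact map_mem_closure (f := fun x => (p : ℝ) * x) (by fun_prop) hx hOmul
    · intro x hx hMx
      rw [Metric.mem_closure_iff] at hx ⊢
      intro ε hε
      obtain ⟨y, hy, hd⟩ := hx (min ε (x - M)) (lt_min hε (by linarith))
      have hd1 := hd.trans_le (min_le_left _ _)
      have hd2 := hd.trans_le (min_le_right _ _)
      rw [Real.dist_eq, abs_lt] at hd2
      refine ⟨y - 1, hOsub y hy (by linarith), ?_⟩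
      simpa [Real.dist_eq] using hd1
  have hsO : s ∈ closure O := hCmin.le_of_le hOF hOC hsC
  rw [Metric.mem_closure_iff] at hsO
  obtain ⟨y, hy, hd⟩ := hsO δ hδ
  have hys : y = s := hiso y hy.1 (by rwa [dist_comm, Real.dist_eq] at hd)
  obtain ⟨-, n, k, hn, hx, -⟩ := hy
  obtain ⟨q, hq⟩ := rat_of_eq p hp s 0 n 0 k (by omega) (by rw [← hx, hys]; simp)
  exact ⟨q, hq ▸ hCA hsC⟩

theorem dyn (D : Set ℝ) (p M : ℕ) (hp : 2 ≤ p) (hM : 1 ≤ M) (hpos : ∀ x ∈ D, 0 < x)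
    (wf : ∀ S ⊆ D, S.Nonempty → ∃ x, IsLeast S x)
    (hcl : ∀ x, (∀ δ > 0, ∃ y ∈ D, x - δ < y ∧ y < x) → x ∈ D)
    (hmul : ∀ x ∈ D, (p : ℝ) * x ∈ D) (hsub : ∀ x ∈ D, (M : ℝ) < x → x - 1 ∈ D)
    (hno : ∀ q : ℚ, ¬ IsAccumulationPt D (q : ℝ)) :
    (∀ x : ℝ, ¬ IsAccumulationPt D x) ∧ (∀ c ∈ D, ∃ q : ℚ, c = (q : ℝ)) := by
  have hp' : (2 : ℝ) ≤ p := by exact_mod_cast hp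
  have hbelow : ∀ x, IsAccumulationPt D x → ∀ δ > 0, ∃ y ∈ D, x - δ < y ∧ y < x := by
    intro x hx δ hδ
    by_cases hE : (D ∩ Set.Ioi x).Nonempty
    · obtain ⟨z, ⟨hzC, hzs⟩, hz⟩ := wf _ Set.inter_subset_left hE
      have hzs' : x < z := hzs
      obtain ⟨y, hy, hne, hd⟩ := hx (min δ (z - x)) (lt_min hδ (by linarith))
      have hd1 := hd.trans_le (min_le_left _ _)
      have hd2 := hd.trans_le (min_le_right _ _)
      rw [abs_lt] at hd1 hd2
      refine ⟨y, hy, by linarith, lt_of_le_of_ne ?_ hne⟩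
      by_contra! hlt
      have := hz ⟨hy, hlt⟩
      linarith
    · obtain ⟨y, hy, hne, hd⟩ := hx δ hδ
      rw [abs_lt] at hd
      refine ⟨y, hy, by linarith, lt_of_le_of_ne ?_ hne⟩
      by_contra! hlt
      exact hE ⟨y, hy, hlt⟩
  have hAD : {x | IsAccumulationPt D x} ⊆ D := fun x hx => hcl x (hbelow x hx)
  have hA : ∀ x : ℝ, ¬ IsAccumulationPt D x := by
    intro x hx
    obtain ⟨q, hq⟩ := exists_rat {x | IsAccumulationPt D x} p M hp hM
      (fun x hx => hpos x (hAD hx)) (fun S hS => wf S (hS.trans hAD))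
      (by
        have : {x | IsAccumulationPt D x} = derivedSet D := by ext x; exact isAcc_iff D x
        rw [this]; exact isClosed_derivedSet D)
      (by
        intro x hx ε hε
        obtain ⟨y, hy, hne, hd⟩ := hx (ε / p) (by positivity)
        refine ⟨p * y, hmul y hy, fun h => hne (mul_left_cancel₀ (by positivity) h), ?_⟩
        rw [← mul_sub, abs_mul, abs_of_pos (by positivity)]
        rw [lt_div_iff₀ (by positivity)] at hd
        linarith)
      (by
        intro x hx hMx ε hε
        obtain ⟨y, hy, hne, hd⟩ := hx (min ε (x - M)) (lt_min hε (by linarith))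
        have hd1 := hd.trans_le (min_le_left _ _)
        have hd2 := hd.trans_le (min_le_right _ _)
        rw [abs_lt] at hd2
        refine ⟨y - 1, hsub y hy (by linarith), fun h => hne (by linarith), ?_⟩
        simpa using hd1)
      ⟨x, hx⟩
    exact hno q hq
  refine ⟨hA, fun c hc => ?_⟩
  have hfin : (D ∩ Set.Icc (M : ℝ) (M + 1)).Finite := by
    by_contra hinf
    obtain ⟨x, -, hx⟩ := Set.Infinite.exists_accPt_of_subset_isCompact hinf
      (isCompact_Icc (a := (M : ℝ)) (b := M + 1)) Set.inter_subset_right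
    exact hA x ((isAcc_iff D x).mpr (hx.mono (Filter.principal_mono.mpr Set.inter_subset_left)))
  obtain ⟨N, hN⟩ := big p M hp c (hpos c hc)
  have hk : ∀ n : ℕ, ∃ k : ℕ, (p : ℝ) ^ (N + n) * c - k ∈ D ∩ Set.Icc (M : ℝ) (M + 1) := by
    intro n
    have h1 : (M : ℝ) < (p : ℝ) ^ (N + n) * c := by
      refine hN.trans_le (mul_le_mul_of_nonneg_right ?_ (hpos c hc).le)
      exact pow_le_pow_right₀ (by linarith) (by omega)
    obtain ⟨k, hk, h1, h2⟩ := sub_many' D M hsub _ (mul_many D p hmul c hc (N + n)) h1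
    exact ⟨k, hk, h1.le, h2⟩
  choose k hk using hk
  obtain ⟨n, -, n', -, hne, heq⟩ := Set.infinite_univ.exists_ne_map_eq_of_mapsTo
    (f := fun n : ℕ => (p : ℝ) ^ (N + n) * c - k n) (fun n _ => hk n) hfin
  rcases lt_or_gt_of_ne hne with h | h
  · exact rat_of_eq p hp c (N + n) (N + n') _ _ (by omega) heq
  · exact rat_of_eq p hp c (N + n') (N + n) _ _ (by omega) heq.symm

/-- If the F-jumping coefficients of `a` have no rational accumulation points, then they
have no accumulation points at all and every F-jumping coefficient of `a` is rational. -/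
theorem stmt1 {R : Type*} [CommRing R] [IsNoetherianRing R] [IsLocalRing R]
    (p : ℕ) (hp : p.Prime) [CharP R p]
    (hreg : IsRegularStmt R) (hstar : CondStar R p) (a : Ideal R)
    (hnoacc : ∀ q : ℚ, ¬ IsAccumulationPt {c : ℝ | IsFJumpingCoeff p a c} (q : ℝ)) :
    (∀ x : ℝ, ¬ IsAccumulationPt {c : ℝ | IsFJumpingCoeff p a c} x) ∧
    (∀ c : ℝ, IsFJumpingCoeff p a c → ∃ q : ℚ, c = (q : ℝ)) := by
  have : Fact p.Prime := ⟨hp⟩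
  obtain ⟨s, hs, hcard⟩ := hreg
  have : IsDomain R := aux_domain s.card R s hs le_rfl hcard.le
  obtain ⟨m, hm1, hm⟩ := tau_skoda hstar a
  exact dyn _ p m hp.two_le hm1 (fun x hx => hx.1) jump_wf (fun x hx => jump_closed x hx)
    (fun x hx => jump_mul hp.pos hstar hx) (fun x hx h => jump_sub hm1 hm h hx) hnoacc
end

section
/- Let R be a complete regular local ring of prime characteristic p > 0. Then for every ideal a of R and every integer e ≥ 1, a ⊆ I_e(a)^{[p^e]}; consequently I_e(a) is the unique smallest element, with respect to inclusion, of the set of ideals I of R satisfying a ⊆ I^{[p^e]}. -/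
/-- Length of the cyclic module `R/J`. -/
noncomputable def qlen {R : Type*} [CommRing R] (J : Ideal R) : ℕ∞ := Module.length R (R ⧸ J)

lemma qlen_colon {R : Type*} [CommRing R] (J K : Ideal R) (r : R)
    (hK : ∀ s, s ∈ K ↔ s * r ∈ J) :
    qlen J = qlen K + qlen (J ⊔ Ideal.span {r}) := by
  have hK' : K ≤ Submodule.comap (LinearMap.toSpanSingleton R R r) J := by
    intro s hs
    simpa using (hK s).1 hs
  have hle : J ≤ J ⊔ Ideal.span {r} := le_sup_left
  refine Module.length_eq_add_of_exact
    (Submodule.mapQ K J (LinearMap.toSpanSingleton R R r) hK')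
    (Submodule.factor hle) ?_ (Submodule.factor_surjective hle) ?_
  · rw [← LinearMap.ker_eq_bot, LinearMap.ker_eq_bot']
    intro m
    obtain ⟨s, rfl⟩ := Submodule.Quotient.mk_surjective _ m
    intro h
    rw [Submodule.mapQ_apply, Submodule.Quotient.mk_eq_zero] at h
    rw [Submodule.Quotient.mk_eq_zero]
    exact (hK s).2 (by simpa using h)
  · intro m
    obtain ⟨s, rfl⟩ := Submodule.Quotient.mk_surjective _ m
    have : Submodule.factor hle (Submodule.Quotient.mk s) = Submodule.Quotient.mk s := rfl
    rw [this, Submodule.Quotient.mk_eq_zero]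
    constructor
    · intro h
      obtain ⟨j, hj, t, ht, rfl⟩ := Submodule.mem_sup.1 h
      obtain ⟨c, rfl⟩ := Ideal.mem_span_singleton'.1 ht
      refine ⟨Submodule.Quotient.mk c, ?_⟩
      rw [Submodule.mapQ_apply, Submodule.Quotient.eq]
      simpa using hj
    · rintro ⟨n, hn⟩
      obtain ⟨c, rfl⟩ := Submodule.Quotient.mk_surjective _ n
      rw [Submodule.mapQ_apply, Submodule.Quotient.eq] at hn
      have h2 : c * r - s ∈ J := by simpa using hn
      have : s = c * r - (c * r - s) := by ring
      rw [this]
      exact Submodule.sub_mem _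
        (Submodule.mem_sup_right (Ideal.mem_span_singleton'.2 ⟨c, rfl⟩))
        (Submodule.mem_sup_left h2)

lemma qlen_top {R : Type*} [CommRing R] : qlen (⊤ : Ideal R) = 0 := by
  unfold qlen
  rw [Module.length_eq_zero_iff]
  exact Submodule.Quotient.subsingleton_iff.2 rfl

lemma qlen_anti {R : Type*} [CommRing R] {J K : Ideal R} (h : J ≤ K) : qlen K ≤ qlen J :=
  Module.length_le_of_surjective (Submodule.factor h) (Submodule.factor_surjective h)

lemma qlen_pos {R : Type*} [CommRing R] {J : Ideal R} (h : J ≠ ⊤) : qlen J ≠ 0 := by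
  unfold qlen
  rw [Ne, Module.length_eq_zero_iff, Submodule.Quotient.subsingleton_iff]
  exact h

lemma qlen_eq {R : Type*} [CommRing R] {J K : Ideal R} (h : J ≤ K) (h2 : qlen J = qlen K)
    (h3 : qlen J ≠ ⊤) : J = K := by
  by_contra hne
  obtain ⟨r, hrK, hrJ⟩ := SetLike.exists_of_lt (lt_of_le_of_ne h hne)
  have h4 := qlen_colon J (Submodule.comap (LinearMap.toSpanSingleton R R r) J) r (by intro s; simp)
  have h5 : J ⊔ Ideal.span {r} ≤ K := sup_le h (by simpa [Ideal.span_le] using hrK)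
  have h6 := qlen_anti h5
  have h7 : qlen (Submodule.comap (LinearMap.toSpanSingleton R R r) J : Ideal R) ≠ 0 := by
    apply qlen_pos
    rw [Ideal.ne_top_iff_one]
    simpa using hrJ
  rw [← h2, h4] at h6
  rw [h4] at h3
  generalize qlen (J ⊔ Ideal.span {r}) = a at *
  generalize qlen (Submodule.comap (LinearMap.toSpanSingleton R R r) J : Ideal R) = b at *
  have ha : a ≠ ⊤ := by rintro rfl; simp at h3
  have hb : b ≠ ⊤ := by rintro rfl; simp at h3
  lift a to ℕ using ha
  lift b to ℕ using hb
  norm_cast at *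
  omega

lemma qlen_inf_sup {R : Type*} [CommRing R] (A B : Ideal R) :
    qlen A + qlen B = qlen (A ⊓ B) + qlen (A ⊔ B) := by
  unfold qlen
  rw [← Module.length_prod]
  have h1 : A ⊓ B ≤ A := inf_le_left
  have h2 : A ⊓ B ≤ B := inf_le_right
  have h3 : A ≤ A ⊔ B := le_sup_left
  have h4 : B ≤ A ⊔ B := le_sup_right
  refine Module.length_eq_add_of_exact
    ((Submodule.factor h1).prod (Submodule.factor h2))
    ((Submodule.factor h3).coprod (-(Submodule.factor h4))) ?_ ?_ ?_
  · rw [← LinearMap.ker_eq_bot, LinearMap.ker_eq_bot']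
    intro m
    obtain ⟨s, rfl⟩ := Submodule.Quotient.mk_surjective _ m
    intro h
    have ha : (Submodule.Quotient.mk s : R ⧸ A) = 0 := congrArg Prod.fst h
    have hb : (Submodule.Quotient.mk s : R ⧸ B) = 0 := congrArg Prod.snd h
    rw [Submodule.Quotient.mk_eq_zero] at *
    exact ⟨ha, hb⟩
  · intro y
    obtain ⟨z, rfl⟩ := Submodule.factor_surjective h3 y
    exact ⟨(z, 0), by simp⟩
  · rintro ⟨y, z⟩
    obtain ⟨s, rfl⟩ := Submodule.Quotient.mk_surjective _ y
    obtain ⟨t, rfl⟩ := Submodule.Quotient.mk_surjective _ z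
    have : (LinearMap.coprod (Submodule.factor h3) (-(Submodule.factor h4)))
      (Submodule.Quotient.mk s, Submodule.Quotient.mk t) = Submodule.Quotient.mk (s - t) := by
      rw [LinearMap.coprod_apply, LinearMap.neg_apply, ← sub_eq_add_neg]
      rfl
    rw [this, Submodule.Quotient.mk_eq_zero]
    constructor
    · intro h
      obtain ⟨j, hj, k, hk, hjk⟩ := Submodule.mem_sup.1 h
      refine ⟨Submodule.Quotient.mk (s - j), Prod.ext ?_ ?_⟩
      · change (Submodule.Quotient.mk (s - j) : R ⧸ A) = Submodule.Quotient.mk s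
        rw [Submodule.Quotient.eq]
        simpa using hj
      · change (Submodule.Quotient.mk (s - j) : R ⧸ B) = Submodule.Quotient.mk t
        rw [Submodule.Quotient.eq]
        have : s - j - t = k := by linear_combination -hjk
        rwa [this]
    · rintro ⟨w, hw⟩
      obtain ⟨c, rfl⟩ := Submodule.Quotient.mk_surjective _ w
      have ha : (Submodule.Quotient.mk c : R ⧸ A) = Submodule.Quotient.mk s := congrArg Prod.fst hw
      have hb : (Submodule.Quotient.mk c : R ⧸ B) = Submodule.Quotient.mk t := congrArg Prod.snd hw
      rw [Submodule.Quotient.eq] at *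
      have : s - t = -(c - s) + (c - t) := by ring
      rw [this]
      exact Submodule.add_mem_sup (neg_mem ha) hb

lemma qlen_pow {R : Type*} [CommRing R] (J : Ideal R) (x : R) (hx : ∀ r, x * r ∈ J → r ∈ J)
    (a : ℕ) : qlen (J ⊔ Ideal.span {x ^ a}) = a * qlen (J ⊔ Ideal.span {x}) := by
  induction a with
  | zero => simp [qlen_top, Ideal.span_singleton_one]
  | succ a ih =>
    have hxa : ∀ a : ℕ, ∀ r, x ^ a * r ∈ J → r ∈ J := by
      intro a
      induction a with
      | zero => simp
      | succ a ih =>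
        intro r h
        apply hx
        apply ih
        rwa [← mul_assoc, ← pow_succ]
    have h := qlen_colon (J ⊔ Ideal.span {x ^ (a + 1)}) (J ⊔ Ideal.span {x}) (x ^ a) (by
      intro s
      simp only [Submodule.mem_sup, Ideal.mem_span_singleton']
      constructor
      · rintro ⟨j, hj, _, ⟨c, rfl⟩, rfl⟩
        exact ⟨x ^ a * j, Ideal.mul_mem_left _ _ hj, _, ⟨c, rfl⟩, by ring⟩
      · rintro ⟨j, hj, _, ⟨c, rfl⟩, h⟩
        refine ⟨s - c * x, hxa a _ ?_, _, ⟨c, rfl⟩, by ring⟩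
        have : x ^ a * (s - c * x) = j := by linear_combination -h
        rwa [this])
    have e0 : Ideal.span {x ^ (a + 1)} ≤ Ideal.span {x ^ a} := by
      rw [Ideal.span_singleton_le_span_singleton]
      exact pow_dvd_pow _ (by omega)
    have e2 : Ideal.span {x ^ (a + 1)} ⊔ Ideal.span {x ^ a} = Ideal.span {x ^ a} := sup_eq_right.2 e0
    rw [h, sup_assoc, e2, ih]
    push_cast; ring


open IsLocalRing RingTheory.Sequence in
lemma qlen_list {R : Type*} [CommRing R] [IsLocalRing R] [IsNoetherianRing R] (a : ℕ) (ha : 1 ≤ a)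
    (l1 : List R) : ∀ (l2 : List R), (∀ r ∈ l1 ++ l2, r ∈ maximalIdeal R) →
    IsWeaklyRegular R (l1 ++ l2) →
    qlen (Ideal.ofList (l2 ++ l1.map (· ^ a))) = a ^ l1.length * qlen (Ideal.ofList (l1 ++ l2)) := by
  induction l1 with
  | nil => intro l2; simp
  | cons x t ih =>
    intro l2 hm hreg
    have h1 : IsWeaklyRegular R ((t ++ l2) ++ [x]) :=
      isWeaklyRegular_of_perm_of_subset_maximalIdeal hreg
        (by simpa using (List.perm_append_singleton x (t ++ l2)).symm) hm
    rw [isWeaklyRegular_append_iff, isWeaklyRegular_singleton_iff] at h1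
    have h2 : IsWeaklyRegular R (t ++ (l2 ++ [x ^ a])) := by
      rw [← List.append_assoc, isWeaklyRegular_append_iff, isWeaklyRegular_singleton_iff]
      exact ⟨h1.1, h1.2.pow a⟩
    have hx : ∀ r, x * r ∈ Ideal.ofList (t ++ l2) → r ∈ Ideal.ofList (t ++ l2) := by
      intro r hr
      have h3 := isSMulRegular_iff_right_eq_zero_of_smul.1 h1.2 (Submodule.Quotient.mk r)
      rw [← Submodule.Quotient.mk_smul, Submodule.Quotient.mk_eq_zero,
        Submodule.Quotient.mk_eq_zero] at h3
      simpa using h3 (by simpa using hr)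
    have h4 := ih (l2 ++ [x ^ a]) (by
      intro r hr
      simp only [List.mem_append, List.mem_singleton] at hr
      rcases hr with hr | hr | rfl
      · exact hm r (by simp [hr])
      · exact hm r (by simp [hr])
      · exact Ideal.pow_mem_of_mem _ (hm x (by simp)) a ha) h2
    have h5 := qlen_pow _ x hx a
    have e1 : l2 ++ List.map (· ^ a) (x :: t) = l2 ++ [x ^ a] ++ List.map (· ^ a) t := by simp
    rw [e1, h4, ← List.append_assoc, Ideal.ofList_append, Ideal.ofList_singleton, h5,
      List.length_cons, List.cons_append, Ideal.ofList_cons x, sup_comm (Ideal.span {x}), pow_succ]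
    ring

open IsLocalRing in
/-- `rs` generates the maximal ideal and has `dim R` entries. -/
def RegL (R : Type*) [CommRing R] [IsLocalRing R] (rs : List R) : Prop :=
  maximalIdeal R = Ideal.ofList rs ∧ ringKrullDim R = rs.length

lemma span_sup_eq_of_sub {R : Type*} [CommRing R] (x z : R) (J : Ideal R) (h : x - z ∈ J) :
    Ideal.span {x} ⊔ J = Ideal.span {z} ⊔ J := by
  apply le_antisymm <;> refine sup_le ?_ le_sup_right <;> rw [Ideal.span_singleton_le_iff_mem]
  · have : x = z + (x - z) := by ring
    rw [this]
    exact Submodule.add_mem_sup (Ideal.mem_span_singleton_self z) h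
  · have : z = x + -(x - z) := by ring
    rw [this]
    exact Submodule.add_mem_sup (Ideal.mem_span_singleton_self x) (neg_mem h)

open IsLocalRing in
lemma list_exchange {R : Type*} [CommRing R] [IsLocalRing R] (rs : List R) :
    ∀ x ∈ Ideal.ofList rs, x ∈ maximalIdeal R * Ideal.ofList rs ∨
      ∃ t : List R, t.length + 1 = rs.length ∧ Ideal.ofList (x :: t) = Ideal.ofList rs := by
  induction rs with
  | nil => intro x hx; left; simpa using hx
  | cons y r ih =>
    intro x hx
    rw [Ideal.ofList_cons] at hx
    obtain ⟨w, hw, z, hz, rfl⟩ := Submodule.mem_sup.1 hx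
    obtain ⟨c, rfl⟩ := Ideal.mem_span_singleton'.1 hw
    by_cases hc : IsUnit c
    · right
      refine ⟨r, rfl, ?_⟩
      rw [Ideal.ofList_cons, Ideal.ofList_cons, span_sup_eq_of_sub _ (c * y) _ (by simpa using hz),
        Ideal.span_singleton_mul_left_unit hc]
    · have hc' : c ∈ maximalIdeal R := hc
      rcases ih z hz with h | ⟨t, ht, h⟩
      · left
        rw [Ideal.ofList_cons, Ideal.mul_sup]
        exact Submodule.add_mem_sup
          (Ideal.mul_mem_mul hc' (Ideal.mem_span_singleton_self y)) h
      · right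
        refine ⟨y :: t, by simp [ht], ?_⟩
        rw [Ideal.ofList_cons, Ideal.ofList_cons, Ideal.ofList_cons, ← h, Ideal.ofList_cons,
          span_sup_eq_of_sub _ z, sup_left_comm]
        simp only [add_sub_cancel_right]
        exact Submodule.mem_sup_left (Ideal.mul_mem_left _ _ (Ideal.mem_span_singleton_self y))

open IsLocalRing in
lemma ringKrullDim_le_length {R : Type*} [CommRing R] [IsLocalRing R] [IsNoetherianRing R]
    (rs : List R) (h : maximalIdeal R = Ideal.ofList rs) : ringKrullDim R ≤ rs.length := by
  classical
  rw [← IsLocalRing.maximalIdeal_height_eq_ringKrullDim]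
  have h1 := Ideal.height_le_spanFinrank (maximalIdeal R) Ideal.IsPrime.ne_top'
  have h2 : (maximalIdeal R).spanFinrank ≤ rs.length := by
    rw [h]
    have e : {r | r ∈ rs} = (rs.toFinset : Set R) := by ext; simp
    have := Submodule.spanFinrank_span_le_ncard_of_finite (R := R) (s := {r | r ∈ rs})
      (by rw [e]; exact Finset.finite_toSet _)
    refine this.trans ?_
    rw [e, Set.ncard_coe_finset]
    exact List.toFinset_card_le rs
  have h3 : (maximalIdeal R).height ≤ (rs.length : ℕ∞) := h1.trans (by exact_mod_cast h2)
  exact_mod_cast h3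

open IsLocalRing in
lemma RegL.quot {R : Type*} [CommRing R] [IsLocalRing R] [IsNoetherianRing R] (x : R)
    (rs : List R) (h : RegL R (x :: rs)) [IsLocalRing (R ⧸ Ideal.span {x})] :
    RegL (R ⧸ Ideal.span {x}) (rs.map (Ideal.Quotient.mk (Ideal.span {x}))) := by
  have hm : maximalIdeal (R ⧸ Ideal.span {x}) =
      Ideal.ofList (rs.map (Ideal.Quotient.mk (Ideal.span {x}))) := by
    rw [← map_maximalIdeal_of_surjective (Ideal.Quotient.mk (Ideal.span {x}))
      Ideal.Quotient.mk_surjective, h.1, Ideal.map_ofList, List.map_cons, Ideal.ofList_cons]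
    have : Ideal.Quotient.mk (Ideal.span {x}) x = 0 :=
      Ideal.Quotient.eq_zero_iff_mem.2 (Ideal.mem_span_singleton_self x)
    simp [this]
  refine ⟨hm, le_antisymm (ringKrullDim_le_length _ hm) ?_⟩
  have hx : x ∈ maximalIdeal R := by
    rw [h.1, Ideal.ofList_cons]
    exact Submodule.mem_sup_left (Ideal.mem_span_singleton_self x)
  have h1 := Ideal.height_le_ringKrullDim_quotient_add_one hx
  rw [IsLocalRing.maximalIdeal_height_eq_ringKrullDim, h.2] at h1
  have h2 := ringKrullDim_le_length _ hm
  rw [List.length_map] at h2 ⊢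
  generalize ringKrullDim (R ⧸ Ideal.span {x}) = D at *
  induction D using WithBot.recBotCoe with
  | bot =>
    rw [WithBot.bot_add] at h1
    simp only [le_bot_iff] at h1
    exact absurd h1 (WithBot.natCast_ne_bot _)
  | coe D =>
    have h3 : ((rs.length + 1 : ℕ) : ℕ∞) ≤ D + 1 := by
      rw [List.length_cons] at h1
      exact_mod_cast h1
    have h4 : ((rs.length : ℕ) : ℕ∞) ≤ D := by
      push_cast at h3
      exact (ENat.add_le_add_iff_right ENat.one_ne_top).1 h3
    exact_mod_cast h4

open IsLocalRing in
lemma isLocalRing_quot {R : Type*} [CommRing R] [IsLocalRing R] (x : R)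
    (hx : x ∈ maximalIdeal R) : IsLocalRing (R ⧸ Ideal.span {x}) := by
  have : Nontrivial (R ⧸ Ideal.span {x}) :=
    Ideal.Quotient.nontrivial_iff.2 (fun h => by
      rw [Ideal.span_singleton_eq_top] at h
      exact hx h)
  exact IsLocalRing.of_surjective' (Ideal.Quotient.mk _) Ideal.Quotient.mk_surjective

open IsLocalRing in
lemma RegL.isDomain (n : ℕ) : ∀ {R : Type*} [CommRing R] [IsLocalRing R] [IsNoetherianRing R]
    (rs : List R) (_ : rs.length = n) (_ : RegL R rs), IsDomain R := by
  induction n with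
  | zero =>
    intro R _ _ _ rs hn h
    have : rs = [] := List.length_eq_zero_iff.1 hn
    subst this
    have hb : maximalIdeal R = ⊥ := by simpa using h.1
    exact ((IsLocalRing.isField_iff_maximalIdeal_eq).2 hb).isDomain
  | succ n ih =>
    intro R _ _ _ rs hn h
    have hdim : ringKrullDim R ≠ 0 := by
      rw [h.2, hn]
      exact_mod_cast Nat.succ_ne_zero n
    obtain ⟨x, hxm, hx2, hxP⟩ : ∃ x ∈ maximalIdeal R, x ∉ maximalIdeal R ^ 2 ∧
        ∀ P ∈ minimalPrimes R, x ∉ P := by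
      by_contra hcon
      push Not at hcon
      have hfin : (insert (maximalIdeal R ^ 2) (minimalPrimes R)).Finite :=
        (minimalPrimes.finite_of_isNoetherianRing R).insert _
      have hsub : (maximalIdeal R : Set R) ⊆
          ⋃ i ∈ insert (maximalIdeal R ^ 2) (minimalPrimes R), ((id i : Ideal R) : Set R) := by
        intro x hx
        simp only [Set.mem_iUnion]
        by_cases h2 : x ∈ maximalIdeal R ^ 2
        · exact ⟨_, Set.mem_insert _ _, h2⟩
        · obtain ⟨P, hP, hxP⟩ := hcon x hx h2
          exact ⟨P, Set.mem_insert_of_mem _ hP, hxP⟩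
      rw [Ideal.subset_union_prime_finite hfin (maximalIdeal R ^ 2) (maximalIdeal R ^ 2) (by
        intro i hi hne _
        rcases hi with rfl | hi
        · exact absurd rfl hne
        · exact hi.1.1)] at hsub
      obtain ⟨i, rfl | hi, hle⟩ := hsub
      · have hb : maximalIdeal R = ⊥ := by
          apply Submodule.eq_bot_of_le_smul_of_le_jacobson_bot (maximalIdeal R) _
            (IsNoetherian.noetherian _)
          · simpa [pow_two] using hle
          · exact maximalIdeal_le_jacobson _
        exact hdim (ringKrullDim_eq_zero_of_isField
          ((IsLocalRing.isField_iff_maximalIdeal_eq).2 hb))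
      · have := hi.1.1
        have he : i = maximalIdeal R :=
          le_antisymm (le_maximalIdeal this.ne_top) hle
        apply hdim
        rw [← IsLocalRing.maximalIdeal_height_eq_ringKrullDim, ← he]
        have := Ideal.height_eq_zero_iff.2 hi
        rw [this]; rfl
    have hxm' := hxm
    rw [h.1] at hxm'
    rcases list_exchange rs x hxm' with hcase | ⟨t, ht, hcase⟩
    · rw [← h.1, ← pow_two] at hcase
      exact absurd hcase hx2
    have hreg : RegL R (x :: t) := ⟨by rw [hcase, h.1], by rw [h.2, List.length_cons, ht]⟩
    have := isLocalRing_quot x hxm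
    have hd := ih _ (by rw [List.length_map]; omega) (hreg.quot)
    rw [Ideal.Quotient.isDomain_iff_prime] at hd
    obtain ⟨P, hP, hPx⟩ := Ideal.exists_minimalPrimes_le (I := ⊥) (J := Ideal.span {x}) bot_le
    have hPp : P.IsPrime := hP.1.1
    have hxP' : x ∉ P := hxP P hP
    have hPb : P = ⊥ := by
      apply Submodule.eq_bot_of_le_smul_of_le_jacobson_bot (maximalIdeal R) _
        (IsNoetherian.noetherian _)
      · intro y hy
        obtain ⟨z, rfl⟩ := Ideal.mem_span_singleton'.1 (hPx hy)
        have hz : z ∈ P := (hPp.mem_or_mem hy).resolve_right hxP'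
        rw [mul_comm]
        exact Submodule.smul_mem_smul hxm hz
      · exact maximalIdeal_le_jacobson _
    rw [hPb] at hPp
    have := Ideal.Quotient.isDomain (⊥ : Ideal R)
    exact (RingEquiv.quotientBot R).symm.toMulEquiv.isDomain _

open IsLocalRing RingTheory.Sequence Pointwise in
lemma RegL.isWeaklyRegular (n : ℕ) : ∀ {R : Type*} [CommRing R] [IsLocalRing R]
    [IsNoetherianRing R] (rs : List R) (_ : rs.length = n) (_ : RegL R rs),
    IsWeaklyRegular R rs := by
  induction n with
  | zero =>
    intro R _ _ _ rs hn h
    have : rs = [] := List.length_eq_zero_iff.1 hn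
    subst this
    exact IsWeaklyRegular.nil R R
  | succ n ih =>
    intro R _ _ _ rs hn h
    have := RegL.isDomain _ rs hn h
    match rs, hn, h with
    | x :: t, hn, h =>
    have hxm : x ∈ maximalIdeal R := by
      rw [h.1, Ideal.ofList_cons]
      exact Submodule.mem_sup_left (Ideal.mem_span_singleton_self x)
    have := isLocalRing_quot x hxm
    have hw := ih _ (by rw [List.length_map]; simpa using hn) (h.quot)
    have hx0 : x ≠ 0 := by
      rintro rfl
      have h1 := ringKrullDim_le_length t (by rw [h.1]; simp [Ideal.ofList_cons])
      rw [h.2, List.length_cons] at h1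
      have : t.length + 1 ≤ t.length := by exact_mod_cast h1
      omega
    rw [isWeaklyRegular_cons_iff]
    refine ⟨?_, ?_⟩
    · exact isSMulRegular_iff_right_eq_zero_of_smul.2 fun m hm => by
        simpa [hx0] using hm
    · rw [← Ideal.Quotient.algebraMap_eq, isWeaklyRegular_map_algebraMap_iff] at hw
      have e : (Ideal.span {x} : Submodule R R) = x • (⊤ : Submodule R R) := by
        rw [← Submodule.ideal_span_singleton_smul]; simp
      exact ((Submodule.quotEquivOfEq _ _ e).isWeaklyRegular_congr t).1 hw

open IsLocalRing in
lemma qlen_max {R : Type*} [CommRing R] [IsLocalRing R] : qlen (maximalIdeal R) = 1 := by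
  unfold qlen
  rw [Module.length_eq_one_iff, isSimpleModule_iff_isCoatom, ← Ideal.isMaximal_def]
  infer_instance

open IsLocalRing in
lemma RegL.qlen_pow {R : Type*} [CommRing R] [IsLocalRing R] [IsNoetherianRing R] {rs : List R}
    (h : RegL R rs) (a : ℕ) (ha : 1 ≤ a) :
    qlen (Ideal.ofList (rs.map (· ^ a))) = ((a ^ rs.length : ℕ) : ℕ∞) := by
  have h1 := qlen_list a ha rs [] (by
    intro r hr
    rw [h.1]
    exact Ideal.subset_span (by simpa using hr)) (by
      simpa using RegL.isWeaklyRegular _ rs rfl h)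
  rw [List.append_nil, List.nil_append, ← h.1, qlen_max] at h1
  rw [h1]
  push_cast
  ring

open IsLocalRing in
lemma RegL.ofList_le {R : Type*} [CommRing R] [IsLocalRing R] {rs : List R}
    (h : RegL R rs) (n : ℕ) : Ideal.ofList (rs.map (· ^ n)) ≤ maximalIdeal R ^ n := by
  refine Ideal.span_le.2 ?_
  intro r hr
  simp only [List.mem_map, Set.mem_ofPred_eq] at hr
  obtain ⟨y, hy, rfl⟩ := hr
  apply Ideal.pow_mem_pow
  rw [h.1]
  exact Ideal.subset_span hy

open IsLocalRing in
lemma RegL.qlen_ne_top {R : Type*} [CommRing R] [IsLocalRing R] [IsNoetherianRing R] {rs : List R}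
    (h : RegL R rs) (n : ℕ) {A : Ideal R} (hA : maximalIdeal R ^ n ≤ A) : qlen A ≠ ⊤ := by
  have h1 : Ideal.ofList (rs.map (· ^ (n + 1))) ≤ A :=
    (h.ofList_le (n + 1)).trans ((Ideal.pow_le_pow_right (Nat.le_succ n)).trans hA)
  have h2 := qlen_anti h1
  rw [h.qlen_pow _ (by omega)] at h2
  exact ne_top_of_le_ne_top (ENat.natCast_ne_top _) h2

open IsLocalRing in
lemma claimL {R : Type*} [CommRing R] [IsLocalRing R] [IsNoetherianRing R] (φ : R →+* R)
    (n : ℕ) (A' : Ideal R) : ∀ A : Ideal R, maximalIdeal R ^ n ≤ A → A ≤ A' →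
    qlen (A.map φ) + qlen ((maximalIdeal R).map φ) * qlen A' ≤
      qlen (A'.map φ) + qlen ((maximalIdeal R).map φ) * qlen A := by
  classical
  intro A
  induction A using WellFoundedGT.induction with
  | ind A ih =>
  intro hn hAA'
  rcases eq_or_lt_of_le hAA' with rfl | hlt
  · exact le_rfl
  have hex : ∃ k, maximalIdeal R ^ k * A' ≤ A := ⟨n, (Ideal.mul_le_left).trans hn⟩
  obtain ⟨r, hrA', hrA, hmr⟩ : ∃ r ∈ A', r ∉ A ∧ ∀ s ∈ maximalIdeal R, s * r ∈ A := by
    have hk := Nat.find_spec hex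
    have hmin : ∀ j < Nat.find hex, ¬ (maximalIdeal R ^ j * A' ≤ A) := fun j => Nat.find_min hex
    generalize Nat.find hex = k at *
    cases k with
    | zero =>
      exfalso
      apply not_le_of_gt hlt
      simpa using hk
    | succ k =>
      obtain ⟨r, hr, hrA⟩ := SetLike.not_le_iff_exists.1 (hmin k (Nat.lt_succ_self k))
      refine ⟨r, Ideal.mul_le_right hr, hrA, fun s hs => hk ?_⟩
      rw [pow_succ', mul_assoc]
      exact Ideal.mul_mem_mul hs hr
  have hBA' : A ⊔ Ideal.span {r} ≤ A' :=
    sup_le hAA' ((Ideal.span_singleton_le_iff_mem _).2 hrA')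
  have hAB : A < A ⊔ Ideal.span {r} := by
    refine lt_of_le_of_ne le_sup_left fun he => hrA ?_
    rw [he]
    exact Submodule.mem_sup_right (Ideal.mem_span_singleton_self r)
  have h1 := ih _ hAB (hn.trans hAB.le) hBA'
  have h2 := qlen_colon A (maximalIdeal R) r (by
    intro s
    refine ⟨hmr s, fun h => ?_⟩
    by_contra hs
    have hu : IsUnit s := by simpa using hs
    exact hrA ((Ideal.unit_mul_mem_iff_mem A hu).1 h))
  rw [qlen_max] at h2
  have h3 := qlen_colon (A.map φ)
    (Submodule.comap (LinearMap.toSpanSingleton R R (φ r)) (A.map φ)) (φ r) (by intro s; simp)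
  have h4 : (maximalIdeal R).map φ ≤
      (Submodule.comap (LinearMap.toSpanSingleton R R (φ r)) (A.map φ) : Ideal R) := by
    rw [Ideal.map_le_iff_le_comap]
    intro s hs
    have h5 : φ (s * r) ∈ A.map φ := Ideal.mem_map_of_mem φ (hmr s hs)
    rw [map_mul] at h5
    simpa using h5
  have h5 := qlen_anti h4
  have e : (A ⊔ Ideal.span {r}).map φ = A.map φ ⊔ Ideal.span {φ r} := by
    rw [Ideal.map_sup, Ideal.map_span, Set.image_singleton]
  rw [e] at h1
  rw [h3, h2]
  generalize qlen ((maximalIdeal R).map φ) = c at *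
  calc _ ≤ c + qlen (A.map φ ⊔ Ideal.span {φ r}) + c * qlen A' := by gcongr
    _ = c + (qlen (A.map φ ⊔ Ideal.span {φ r}) + c * qlen A') := by ring
    _ ≤ c + (qlen (A'.map φ) + c * qlen (A ⊔ Ideal.span {r})) := by gcongr
    _ = _ := by ring

open IsLocalRing in
lemma RegL.qlen_map {R : Type*} [CommRing R] [IsLocalRing R] [IsNoetherianRing R] {rs : List R}
    (h : RegL R rs) (φ : R →+* R) (q : ℕ) (hq : 1 ≤ q) (hφ : ∀ x, φ x = x ^ q)
    (n : ℕ) {A : Ideal R} (hA : maximalIdeal R ^ n ≤ A) :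
    qlen (A.map φ) = ((q ^ rs.length : ℕ) : ℕ∞) * qlen A := by
  have hφl : ∀ l : List R, (Ideal.ofList l).map φ = Ideal.ofList (l.map (· ^ q)) := by
    intro l
    rw [Ideal.map_ofList]
    congr 1
    exact List.map_congr_left fun x _ => hφ x
  have hc : qlen ((maximalIdeal R).map φ) = ((q ^ rs.length : ℕ) : ℕ∞) := by
    rw [h.1, hφl, h.qlen_pow q hq]
  have hN : Ideal.ofList (rs.map (· ^ (n + 1))) ≤ A :=
    (h.ofList_le (n + 1)).trans ((Ideal.pow_le_pow_right (Nat.le_succ n)).trans hA)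
  have hlow := claimL φ n ⊤ A hA le_top
  rw [Ideal.map_top, qlen_top, mul_zero, add_zero, zero_add, hc] at hlow
  refine le_antisymm hlow ?_
  obtain ⟨M, hM⟩ : ∃ M, maximalIdeal R ^ M ≤ Ideal.ofList (rs.map (· ^ (n + 1))) := by
    refine Ideal.exists_pow_le_of_le_radical_of_fg ?_ (IsNoetherian.noetherian _)
    rw [h.1]
    refine Ideal.span_le.2 fun r hr => ?_
    exact ⟨n + 1, Ideal.subset_span (List.mem_map.2 ⟨r, hr, rfl⟩)⟩
  have h1 := claimL φ M A _ hM hN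
  have h2 : qlen ((Ideal.ofList (rs.map (· ^ (n + 1)))).map φ) =
      ((((n + 1) * q) ^ rs.length : ℕ) : ℕ∞) := by
    rw [hφl, List.map_map, ← h.qlen_pow ((n + 1) * q) (Nat.mul_pos (by omega) hq)]
    congr 2
    exact List.map_congr_left fun x _ => by simp [pow_mul]
  rw [h2, hc, h.qlen_pow (n + 1) (by omega)] at h1
  have h3 : ((((n + 1) * q) ^ rs.length : ℕ) : ℕ∞) =
    ((q ^ rs.length : ℕ) : ℕ∞) * (((n + 1) ^ rs.length : ℕ) : ℕ∞) := by
    rw [mul_pow, mul_comm]; norm_cast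
  rw [h3, add_comm (qlen (A.map φ)), ← h3] at h1
  exact (ENat.add_le_add_iff_left (ENat.natCast_ne_top _)).1 h1

open IsLocalRing in
lemma RegL.map_inf {R : Type*} [CommRing R] [IsLocalRing R] [IsNoetherianRing R] {rs : List R}
    (h : RegL R rs) (φ : R →+* R) (q : ℕ) (hq : 1 ≤ q) (hφ : ∀ x, φ x = x ^ q)
    (n : ℕ) {A B : Ideal R} (hA : maximalIdeal R ^ n ≤ A) (hB : maximalIdeal R ^ n ≤ B) :
    (A ⊓ B).map φ = A.map φ ⊓ B.map φ := by
  have hI : maximalIdeal R ^ n ≤ A ⊓ B := le_inf hA hB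
  have hS : maximalIdeal R ^ n ≤ A ⊔ B := hA.trans le_sup_left
  have h1 := qlen_inf_sup A B
  have h2 := qlen_inf_sup (A.map φ) (B.map φ)
  have kI := h.qlen_map φ q hq hφ n hI
  have kS := h.qlen_map φ q hq hφ n hS
  rw [← Ideal.map_sup, kS, h.qlen_map φ q hq hφ n hA, h.qlen_map φ q hq hφ n hB, ← mul_add, h1,
    mul_add, ← kI] at h2
  have fS := h.qlen_ne_top n hS
  have fI := h.qlen_ne_top n hI
  have f : ((q ^ rs.length : ℕ) : ℕ∞) * qlen (A ⊔ B) ≠ ⊤ := by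
    lift qlen (A ⊔ B) to ℕ using fS with v
    exact_mod_cast ENat.natCast_ne_top _
  refine qlen_eq (le_inf (Ideal.map_mono inf_le_left) (Ideal.map_mono inf_le_right))
    (WithTop.add_right_cancel f h2) ?_
  rw [kI]
  lift qlen (A ⊓ B) to ℕ using fI with v
  exact_mod_cast ENat.natCast_ne_top _

open IsLocalRing in
lemma iInf_sup_pow {R : Type*} [CommRing R] [IsLocalRing R] [IsNoetherianRing R] (I : Ideal R)
    (y : R) (h : ∀ n, y ∈ I ⊔ maximalIdeal R ^ n) : y ∈ I := by
  have h1 := Ideal.iInf_pow_smul_eq_bot_of_isLocalRing (M := R ⧸ I) (maximalIdeal R)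
    Ideal.IsPrime.ne_top'
  have h2 : (Submodule.Quotient.mk y : R ⧸ I) ∈
      (⨅ i : ℕ, maximalIdeal R ^ i • ⊤ : Submodule R (R ⧸ I)) := by
    rw [Submodule.mem_iInf]
    intro n
    obtain ⟨i, hi, z, hz, rfl⟩ := Submodule.mem_sup.1 (h n)
    have e : (Submodule.Quotient.mk (i + z) : R ⧸ I) = z • Submodule.Quotient.mk 1 := by
      rw [← Submodule.Quotient.mk_smul, Submodule.Quotient.eq]
      simpa using hi
    rw [e]
    exact Submodule.smul_mem_smul hz trivial
  rw [h1, Submodule.mem_bot, Submodule.Quotient.mk_eq_zero] at h2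
  exact h2

open IsLocalRing in
lemma RegL.main {R : Type*} [CommRing R] [IsLocalRing R] [IsNoetherianRing R]
    [IsAdicComplete (maximalIdeal R) R] {rs : List R}
    (h : RegL R rs) (φ : R →+* R) (q : ℕ) (hq : 1 ≤ q) (hφ : ∀ x, φ x = x ^ q) (a : Ideal R) :
    a ≤ (sInf {I : Ideal R | a ≤ I.map φ}).map φ := by
  have hJ : ∀ n : ℕ, ∃ J : Ideal R, a ≤ J.map φ ∧ maximalIdeal R ^ n ≤ J ∧
      ∀ I : Ideal R, a ≤ I.map φ → maximalIdeal R ^ n ≤ I → J ≤ I := by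
    intro n
    have hfl : IsArtinian R (R ⧸ maximalIdeal R ^ n) := by
      have := h.qlen_ne_top n le_rfl
      unfold qlen at this
      rw [Module.length_ne_top_iff, isFiniteLength_iff_isNoetherian_isArtinian] at this
      exact this.2
    obtain ⟨L, hL, hmin⟩ := IsArtinian.set_has_minimal
      {L : Submodule R (R ⧸ maximalIdeal R ^ n) |
        a ≤ Ideal.map φ (L.comap (Submodule.mkQ (maximalIdeal R ^ n)))}
      ⟨⊤, by simp [Ideal.map_top]⟩
    have hnL : maximalIdeal R ^ n ≤ L.comap (Submodule.mkQ (maximalIdeal R ^ n)) := by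
      intro x hx
      have : (Submodule.mkQ (maximalIdeal R ^ n)) x = 0 := (Submodule.Quotient.mk_eq_zero _).2 hx
      simp [this]
    refine ⟨L.comap (Submodule.mkQ (maximalIdeal R ^ n)), hL, hnL, fun I haI hnI => ?_⟩
    set J : Ideal R := L.comap (Submodule.mkQ (maximalIdeal R ^ n)) with hJdef
    have hinf : a ≤ (J ⊓ I).map φ := by
      rw [h.map_inf φ q hq hφ n hnL hnI]
      exact le_inf hL haI
    have hcm : Submodule.comap (Submodule.mkQ (maximalIdeal R ^ n))
        (Submodule.map (Submodule.mkQ (maximalIdeal R ^ n)) (J ⊓ I)) = J ⊓ I := by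
      rw [Submodule.comap_map_mkQ, sup_eq_right]
      exact le_inf hnL hnI
    have h3 := hmin (Submodule.map (Submodule.mkQ (maximalIdeal R ^ n)) (J ⊓ I))
      (by rw [Set.mem_ofPred_eq, hcm]; exact hinf)
    have h4 : Submodule.map (Submodule.mkQ (maximalIdeal R ^ n)) (J ⊓ I) ≤ L := by
      rw [Submodule.map_le_iff_le_comap]
      exact inf_le_left
    have h5 := eq_of_le_of_not_lt h4 h3
    have h6 : J = J ⊓ I := by rw [← hcm, h5]
    rw [h6]
    exact inf_le_right
  choose J haJ hnJ hminJ using hJ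
  have hstep : ∀ n, J n ≤ J (n + 1) ⊔ maximalIdeal R ^ n := fun n =>
    hminJ n _ ((haJ (n + 1)).trans (Ideal.map_mono le_sup_left)) le_sup_right
  have hanti : ∀ m n, m ≤ n → J n ≤ J m := fun m n hmn =>
    hminJ n _ (haJ m) ((Ideal.pow_le_pow_right hmn).trans (hnJ m))
  set I₀ := sInf {I : Ideal R | a ≤ I.map φ} with hI₀
  have hmem : ∀ y, (∀ n, y ∈ J n) → y ∈ I₀ := by
    intro y hy
    rw [hI₀, Submodule.mem_sInf]
    intro I hI
    refine iInf_sup_pow I y fun n => ?_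
    exact hminJ n _ (hI.trans (Ideal.map_mono le_sup_left)) le_sup_right (hy n)
  have hchev : ∀ n, J n ≤ I₀ ⊔ maximalIdeal R ^ n := by
    intro n x hx
    have hlift : ∀ k, ∀ y : J k, ∃ z : J (k + 1), (y : R) - z ∈ maximalIdeal R ^ k := by
      intro k y
      obtain ⟨z, hz, w, hw, he⟩ := Submodule.mem_sup.1 (hstep k y.2)
      exact ⟨⟨z, hz⟩, by rw [← he]; simpa using hw⟩
    choose g hg using hlift
    let f' : ∀ k, J (n + k) := fun k =>
      Nat.rec (motive := fun k => J (n + k)) (⟨x, hx⟩ : J (n + 0)) (fun k y => g (n + k) y) k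
    let f : ℕ → R := fun k => (f' k : R)
    have hf : ∀ k, f k - f (k + 1) ∈ maximalIdeal R ^ (n + k) := fun k => hg (n + k) (f' k)
    have hf' : ∀ k j, f k - f (k + j) ∈ maximalIdeal R ^ (n + k) := by
      intro k j
      induction j with
      | zero => simp
      | succ j ih =>
        have := add_mem ih (Ideal.pow_le_pow_right (by omega) (hf (k + j)))
        rw [sub_add_sub_cancel] at this
        exact this
    obtain ⟨y, hy⟩ := IsPrecomplete.prec (I := maximalIdeal R) (M := R) inferInstance
      (f := f) (by
        intro m k hmk
        obtain ⟨j, rfl⟩ := Nat.exists_eq_add_of_le hmk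
        rw [SModEq.sub_mem]
        simpa using Ideal.pow_le_pow_right (Nat.le_add_left m n) (hf' m j))
    have hy' : ∀ k, f k - y ∈ maximalIdeal R ^ k := by
      intro k
      have := hy k
      rw [SModEq.sub_mem] at this
      simpa using this
    have hyI : y ∈ I₀ := by
      apply hmem
      intro k
      have h1 : f k ∈ J k := hanti k (n + k) (by omega) (f' k).2
      have h2 : f k - y ∈ J k := hnJ k (hy' k)
      have : y = f k - (f k - y) := by ring
      rw [this]
      exact sub_mem h1 h2
    have h0 : x - f n ∈ maximalIdeal R ^ n := by
      have := hf' 0 n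
      rw [zero_add] at this
      exact this
    have : x = y + ((x - f n) + (f n - y)) := by ring
    rw [this]
    exact Submodule.add_mem_sup hyI (add_mem h0 (hy' n))
  intro x hx
  refine iInf_sup_pow _ x fun n => ?_
  have h1 : x ∈ (I₀ ⊔ maximalIdeal R ^ n).map φ := Ideal.map_mono (hchev n) (haJ n hx)
  rw [Ideal.map_sup] at h1
  refine (sup_le_sup_left ?_ ((I₀).map φ) : _ ≤ _) h1
  rw [Ideal.map_le_iff_le_comap]
  intro z hz
  rw [Ideal.mem_comap, hφ]
  exact Ideal.pow_mem_of_mem _ hz q hq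

/-- A complete regular local ring satisfies condition (*): `a ⊆ I_e(a)^{[p^e]}` for every
ideal `a` and every `e ≥ 1`; consequently `I_e(a)` is the smallest ideal `I` with
`a ⊆ I^{[p^e]}`. -/
theorem stmt9 {R : Type*} [CommRing R] [IsNoetherianRing R] [IsLocalRing R]
    [IsAdicComplete (IsLocalRing.maximalIdeal R) R]
    (p : ℕ) (hp : p.Prime) [CharP R p]
    (hreg : IsRegularStmt R) :
    ∀ (a : Ideal R) (e : ℕ), 1 ≤ e →
      a ≤ bracketPow (Ie p a e) (p ^ e) ∧
      ∀ I : Ideal R, a ≤ bracketPow I (p ^ e) → Ie p a e ≤ I := by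
  intro a e _
  refine ⟨?_, fun I hI => sInf_le hI⟩
  obtain ⟨s, hs, hd⟩ := hreg
  have : Fact p.Prime := ⟨hp⟩
  have hR : RegL R s.toList := by
    refine ⟨?_, ?_⟩
    · rw [hs]
      unfold Ideal.ofList
      congr 1
      ext; simp
    · rw [← hd, Finset.length_toList]; rfl
  have hb : ∀ I : Ideal R, bracketPow I (p ^ e) = I.map (iterateFrobenius R p e) := fun I => rfl
  have h := hR.main (iterateFrobenius R p e) (p ^ e) (Nat.pow_pos hp.pos)
    (fun x => iterateFrobenius_def p e x) a
  unfold Ie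
  simp only [hb]
  exact h
end
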